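/- arXiv:2012.03041 — 15 statements merged into one kernel-verified Lean document; each statement's English description precedes it below -/
import Mathlib

section
/- Let S be an inverse semigroup and ρ a complete metric on S such that (S, τ_ρ) is a topological semigroup, where τ_ρ is the topology induced by ρ. Define ρ*(s,t) = ρ(s*, t*) and d = ρ + ρ*. Then d is a complete metric on S and (S, τ_d) is a topological inverse semigroup, i.e. multiplication is jointly τ_d-continuous and the inversion map s ↦ s* is τ_d-continuous. -/
open Filter Topology

/-- In an inverse semigroup, idempotents commute. -/
theorem aux_idem_comm {S : Type*} [Semigroup S] (star : S → S)
    (hstar : ∀ s : S, s * star s * s = s ∧ star s * s * star s = star s)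
    (huniq : ∀ s t : S, s * t * s = s → t * s * t = t → t = star s)
    (e f : S) (he : e * e = e) (hf : f * f = f) : e * f = f * e := by
  have key : ∀ e f : S, e * e = e → f * f = f → (e * f) * (e * f) = e * f := by
    intro e f he hf
    obtain ⟨h1, h2⟩ := hstar (e * f)
    have he' : ∀ y, e * (e * y) = e * y := fun y => by rw [← mul_assoc, he]
    have hf' : ∀ y, f * (f * y) = f * y := fun y => by rw [← mul_assoc, hf]
    generalize hx : star (e * f) = x at h1 h2
    have h2' : ∀ y, x * (e * (f * (x * y))) = x * y := fun y => by
      conv_rhs => rw [← h2]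
      simp only [mul_assoc]
    have h3 : f * x * e = x := by
      rw [← hx]
      apply huniq
      · rw [hx]; simp only [mul_assoc, he', hf'] at h1 ⊢; exact h1
      · rw [hx]; simp only [mul_assoc, he', hf', h2']
    have h4 : x * x = x := by
      have : (f * x * e) * (f * x * e) = f * x * e := by simp only [mul_assoc, h2']
      rwa [h3] at this
    have h5 : x = star x := huniq x x (by rw [h4, h4]) (by rw [h4, h4])
    have h6 : e * f = star x := huniq x (e * f) h2 h1
    rw [h6, ← h5, h4]
  have he' : ∀ y, e * (e * y) = e * y := fun y => by rw [← mul_assoc, he]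
  have hf' : ∀ y, f * (f * y) = f * y := fun y => by rw [← mul_assoc, hf]
  have k1 := key e f he hf
  have k2 := key f e hf he
  have a1 : e * f = star (e * f) := huniq _ _ (by rw [k1, k1]) (by rw [k1, k1])
  have a2 : f * e = star (e * f) := by
    apply huniq
    · simp only [mul_assoc, he', hf'] at k1 ⊢; exact k1
    · simp only [mul_assoc, he', hf'] at k2 ⊢; exact k2
  rw [a1, ← a2]

theorem aux_star_mul {S : Type*} [Semigroup S] (star : S → S)
    (hstar : ∀ s : S, s * star s * s = s ∧ star s * s * star s = star s)
    (huniq : ∀ s t : S, s * t * s = s → t * s * t = t → t = star s)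
    (s t : S) : star (s * t) = star t * star s := by
  have c : (star s * s) * (t * star t) = (t * star t) * (star s * s) := by
    apply aux_idem_comm star hstar huniq
    · rw [← mul_assoc, (hstar s).2]
    · rw [← mul_assoc, (hstar t).1]
  symm
  apply huniq
  · calc s * t * (star t * star s) * (s * t)
        = s * ((t * star t) * (star s * s)) * t := by simp only [mul_assoc]
      _ = (s * star s * s) * (t * star t * t) := by rw [← c]; simp only [mul_assoc]
      _ = s * t := by rw [(hstar s).1, (hstar t).1]
  · calc star t * star s * (s * t) * (star t * star s)
        = star t * ((star s * s) * (t * star t)) * star s := by simp only [mul_assoc]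
      _ = (star t * t * star t) * (star s * s * star s) := by rw [c]; simp only [mul_assoc]
      _ = star t * star s := by rw [(hstar s).2, (hstar t).2]

theorem aux_main {A B : Type*} [Semigroup A] [MetricSpace A] [CompleteSpace A] [MetricSpace B]
    (star : A → A)
    (hstar : ∀ s : A, s * star s * s = s ∧ star s * s * star s = star s)
    (huniq : ∀ s t : A, s * t * s = s → t * s * t = t → t = star s)
    (hmul : Continuous (fun p : A × A => p.1 * p.2))
    (e : B ≃ A)
    (hd : ∀ s t : B, dist s t = dist (e s) (e t) + dist (star (e s)) (star (e t))) :
    CompleteSpace B ∧ Continuous (fun p : B × B => e.symm (e p.1 * e p.2)) ∧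
      Continuous (fun b : B => e.symm (star (e b))) := by
  have c1 : Continuous e := by
    refine (LipschitzWith.of_dist_le_mul (K := 1) fun x y => ?_).continuous
    have := hd x y
    have := dist_nonneg (x := star (e x)) (y := star (e y))
    simp; linarith
  have c2 : Continuous (fun b => star (e b)) := by
    refine (LipschitzWith.of_dist_le_mul (K := 1) fun x y => ?_).continuous
    have := hd x y
    have := dist_nonneg (x := e x) (y := e y)
    simp; linarith
  have lim : ∀ {X : Type _} (l : Filter X) (f : X → B) (b : B),
      Tendsto (fun x => e (f x)) l (𝓝 (e b)) →
      Tendsto (fun x => star (e (f x))) l (𝓝 (star (e b))) → Tendsto f l (𝓝 b) := by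
    intro X l f b h1 h2
    rw [tendsto_iff_dist_tendsto_zero] at h1 h2 ⊢
    simpa [hd] using h1.add h2
  have lim' : ∀ (f : ℕ → B) (b : B),
      Tendsto (fun x => e (f x)) atTop (𝓝 (e b)) →
      Tendsto (fun x => star (e (f x))) atTop (𝓝 (star (e b))) → Tendsto f atTop (𝓝 b) := by
    intro f b h1 h2
    rw [tendsto_iff_dist_tendsto_zero] at h1 h2 ⊢
    simpa [hd] using h1.add h2
  have ss : ∀ s, star (star s) = s := fun s => (huniq _ _ (hstar s).2 (hstar s).1).symm
  refine ⟨?_, ?_, ?_⟩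
  · apply Metric.complete_of_cauchySeq_tendsto
    intro u hu
    have u1 : CauchySeq (fun n => e (u n)) := by
      rw [Metric.cauchySeq_iff] at hu ⊢
      intro ε hε
      obtain ⟨N, hN⟩ := hu ε hε
      refine ⟨N, fun m hm n hn => ?_⟩
      have := hN m hm n hn
      rw [hd] at this
      have := dist_nonneg (x := star (e (u m))) (y := star (e (u n)))
      linarith
    have u2 : CauchySeq (fun n => star (e (u n))) := by
      rw [Metric.cauchySeq_iff] at hu ⊢
      intro ε hε
      obtain ⟨N, hN⟩ := hu ε hε
      refine ⟨N, fun m hm n hn => ?_⟩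
      have := hN m hm n hn
      rw [hd] at this
      have := dist_nonneg (x := e (u m)) (y := e (u n))
      linarith
    obtain ⟨a, ha⟩ := cauchySeq_tendsto_of_complete u1
    obtain ⟨b, hb⟩ := cauchySeq_tendsto_of_complete u2
    have mt : ∀ {f g : ℕ → A} {x y : A}, Tendsto f atTop (𝓝 x) → Tendsto g atTop (𝓝 y) →
        Tendsto (fun n => f n * g n) atTop (𝓝 (x * y)) := fun {f g x y} hf hg =>
      (hmul.tendsto (x, y)).comp (hf.prodMk_nhds hg)
    have e1 : a * b * a = a := by
      have := mt (mt ha hb) ha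
      simp only [(hstar _).1] at this
      exact tendsto_nhds_unique this ha
    have e2 : b * a * b = b := by
      have := mt (mt hb ha) hb
      simp only [(hstar _).2] at this
      exact tendsto_nhds_unique this hb
    have e3 := huniq a b e1 e2
    refine ⟨e.symm a, lim' u _ ?_ ?_⟩
    · simpa using ha
    · simpa [← e3] using hb
  · rw [continuous_iff_continuousAt]
    intro p
    apply lim
    · simp only [Equiv.apply_symm_apply]
      exact (hmul.comp ((c1.comp continuous_fst).prodMk (c1.comp continuous_snd))).tendsto p
    · simp only [Equiv.apply_symm_apply, aux_star_mul star hstar huniq]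
      exact (hmul.comp ((c2.comp continuous_snd).prodMk (c2.comp continuous_fst))).tendsto p
  · rw [continuous_iff_continuousAt]
    intro p
    refine tendsto_iff_dist_tendsto_zero.2 ?_
    have h1 := tendsto_iff_dist_tendsto_zero.1 (c1.tendsto p)
    have h2 := tendsto_iff_dist_tendsto_zero.1 (c2.tendsto p)
    simpa [hd, ss] using h2.add h1

/-- The sum metric. -/
@[reducible] def auxMetric {S : Type*} (star : S → S) (ρ : MetricSpace S) : MetricSpace S where
  dist s t := ρ.dist s t + ρ.dist (star s) (star t)
  dist_self s := by
    change dist s s + dist (star s) (star s) = 0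
    simp
  dist_comm s t := by
    change dist s t + dist (star s) (star t) = dist t s + dist (star t) (star s)
    simp [dist_comm]
  dist_triangle s t u := by
    change dist s u + dist (star s) (star u) ≤
      (dist s t + dist (star s) (star t)) + (dist t u + dist (star t) (star u))
    have := dist_triangle s t u
    have := dist_triangle (star s) (star t) (star u)
    linarith
  eq_of_dist_eq_zero {s t} h := by
    change dist s t + dist (star s) (star t) = 0 at h
    have := dist_nonneg (x := s) (y := t)
    have := dist_nonneg (x := star s) (y := star t)
    exact dist_le_zero.1 (by linarith)

/-- If `S` is an inverse semigroup (with inverse map `star`) and `ρ` is a complete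
metric on `S` whose topology makes multiplication jointly continuous, then
`d = ρ + ρ*` (where `ρ*(s,t) = ρ(star s, star t)`) is a complete metric on `S`
whose topology makes `S` a topological inverse semigroup: multiplication is
jointly continuous and `star` is continuous. -/
theorem sum_metric_is_complete_inverse_semigroup_metric {S : Type*} [Semigroup S]
    (star : S → S)
    (hstar : ∀ s : S, s * star s * s = s ∧ star s * s * star s = star s)
    (huniq : ∀ s t : S, s * t * s = s → t * s * t = t → t = star s)
    (ρ : MetricSpace S)
    (hcomplete : @CompleteSpace S ρ.toUniformSpace)
    (hmul : @Continuous (S × S) S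
      (@instTopologicalSpaceProd S S ρ.toUniformSpace.toTopologicalSpace
        ρ.toUniformSpace.toTopologicalSpace)
      ρ.toUniformSpace.toTopologicalSpace (fun p => p.1 * p.2)) :
    ∃ d : MetricSpace S,
      (∀ s t : S, @dist S d.toDist s t =
        @dist S ρ.toDist s t + @dist S ρ.toDist (star s) (star t)) ∧
      @CompleteSpace S d.toUniformSpace ∧
      @Continuous (S × S) S
        (@instTopologicalSpaceProd S S d.toUniformSpace.toTopologicalSpace
          d.toUniformSpace.toTopologicalSpace)
        d.toUniformSpace.toTopologicalSpace (fun p => p.1 * p.2) ∧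
      @Continuous S S d.toUniformSpace.toTopologicalSpace
        d.toUniformSpace.toTopologicalSpace star := by
  refine ⟨auxMetric star ρ, fun _ _ => rfl, ?_⟩
  exact @aux_main S S _ ρ hcomplete (auxMetric star ρ) star hstar huniq hmul (Equiv.refl S)
    (fun _ _ => rfl)
end

section
/- (I(X), τ₀) is a T₀ topological semigroup (composition is jointly τ₀-continuous and τ₀ is T₀), but if X is nonempty then τ₀ is not T₁. -/
open TopologicalSpace Filter

/-- A partial bijection on `X`, represented by its graph. -/
structure PartialBij (X : Type*) where
  graph : Set (X × X)
  functional : ∀ ⦃x y y'⦄, (x, y) ∈ graph → (x, y') ∈ graph → y = y'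
  coinjective : ∀ ⦃x x' y⦄, (x, y) ∈ graph → (x', y) ∈ graph → x = x'

namespace PartialBij

variable {X : Type*}

/-- Composition `f ∘ g` of partial bijections. -/
def comp (f g : PartialBij X) : PartialBij X where
  graph := {p | ∃ y, (p.1, y) ∈ g.graph ∧ (y, p.2) ∈ f.graph}
  functional := by
    rintro x y y' ⟨z, hz1, hz2⟩ ⟨z', hz1', hz2'⟩
    obtain rfl := g.functional hz1 hz1'
    exact f.functional hz2 hz2'
  coinjective := by
    rintro x x' y ⟨z, hz1, hz2⟩ ⟨z', hz1', hz2'⟩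
    obtain rfl := f.coinjective hz2 hz2'
    exact g.coinjective hz1 hz1'

/-- Inversion `f ↦ f⁻¹` of partial bijections. -/
def inv (f : PartialBij X) : PartialBij X where
  graph := {p | (p.2, p.1) ∈ f.graph}
  functional := fun _ _ _ h h' => f.coinjective h h'
  coinjective := fun _ _ _ h h' => f.functional h h'

/-- Domain of a partial bijection. -/
def dom (f : PartialBij X) : Set X := {x | ∃ y, (x, y) ∈ f.graph}

/-- Image of a partial bijection. -/
def im (f : PartialBij X) : Set X := {y | ∃ x, (x, y) ∈ f.graph}

/-- `v x y = {f : x ∈ dom f and f(x) = y}`. -/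
def v (x y : X) : Set (PartialBij X) := {f | (x, y) ∈ f.graph}

/-- `w₁ x = {f : x ∉ dom f}`. -/
def w1 (x : X) : Set (PartialBij X) := {f | x ∉ f.dom}

/-- `w₂ y = {f : y ∉ im f}`. -/
def w2 (y : X) : Set (PartialBij X) := {f | y ∉ f.im}

/-- The topology generated by the sets `v x y`. -/
def tau0 (X : Type*) : TopologicalSpace (PartialBij X) :=
  generateFrom {s | ∃ x y, s = v x y}

/-- The topology generated by the sets `v x y` and `w₁ x`. -/
def tau1 (X : Type*) : TopologicalSpace (PartialBij X) :=
  generateFrom ({s | ∃ x y, s = v x y} ∪ {s | ∃ x, s = w1 x})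

/-- The topology generated by the sets `v x y` and `w₂ y`. -/
def tau2 (X : Type*) : TopologicalSpace (PartialBij X) :=
  generateFrom ({s | ∃ x y, s = v x y} ∪ {s | ∃ y, s = w2 y})

/-- The partial product topology, generated by the sets `v x y`, `w₁ x` and `w₂ y`. -/
def taupp (X : Type*) : TopologicalSpace (PartialBij X) :=
  generateFrom ({s | ∃ x y, s = v x y} ∪ {s | ∃ x, s = w1 x} ∪ {s | ∃ y, s = w2 y})

/-- The partial identity `1_A` on `A ⊆ X`. -/
def partialId (A : Set X) : PartialBij X where
  graph := {p | p.1 ∈ A ∧ p.1 = p.2}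
  functional := by rintro x y y' ⟨_, h⟩ ⟨_, h'⟩; exact h.symm.trans h'
  coinjective := by rintro x x' y ⟨_, h⟩ ⟨_, h'⟩; exact h.trans h'.symm

/-- The product (Cantor) topology on the power set `2^X`. -/
def cantorTop (X : Type*) : TopologicalSpace (Set X) :=
  generateFrom ({s | ∃ x, s = {A : Set X | x ∈ A}} ∪ {s | ∃ x, s = {A : Set X | x ∉ A}})

open Classical in
/-- Evaluation of a partial bijection at a point of its domain (with junk value `x`
  outside of the domain). -/
noncomputable def evalAt (x : X) (f : PartialBij X) : X :=
  if h : x ∈ f.dom then h.choose else x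

end PartialBij

open PartialBij in
/-- `(I(X), τ₀)` is a `T₀` topological semigroup, but not `T₁` when `X ≠ ∅`. -/
theorem tau0_semitopological_T0_not_T1 (X : Type*) :
    @Continuous (PartialBij X × PartialBij X) (PartialBij X)
      (@instTopologicalSpaceProd _ _ (tau0 X) (tau0 X)) (tau0 X)
      (fun p => p.1.comp p.2) ∧
    @T0Space (PartialBij X) (tau0 X) ∧
    (Nonempty X → ¬ @T1Space (PartialBij X) (tau0 X)) := by
  letI := tau0 X
  have hv : ∀ x y : X, IsOpen (v x y) := fun x y => isOpen_generateFrom_of_mem ⟨x, y, rfl⟩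
  refine ⟨?_, ?_, ?_⟩
  · refine continuous_generateFrom_iff.2 ?_
    rintro _ ⟨x, y, rfl⟩
    have : (fun p : PartialBij X × PartialBij X => p.1.comp p.2) ⁻¹' v x y
        = ⋃ z, v z y ×ˢ v x z := by
      ext p
      simp [v, comp, and_comm]
    rw [this]
    exact isOpen_iUnion fun z => (hv z y).prod (hv x z)
  · refine ⟨fun f g h => ?_⟩
    have hg : f.graph = g.graph := by
      ext ⟨x, y⟩
      exact h.mem_open_iff (hv x y)
    cases f
    cases g
    cases hg
    rfl
  · rintro ⟨x⟩ hT
    have up : ∀ U : Set (PartialBij X), IsOpen U →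
        ∀ f g : PartialBij X, f.graph ⊆ g.graph → f ∈ U → g ∈ U := by
      intro U hU f g hfg
      induction hU with
      | basic s hs =>
        obtain ⟨a, b, rfl⟩ := hs
        exact fun h => hfg h
      | univ => exact fun _ => trivial
      | inter s t _ _ ihs iht => exact fun h => ⟨ihs h.1, iht h.2⟩
      | sUnion S _ ih =>
        rintro ⟨s, hs, h⟩
        exact ⟨s, hs, ih s hs h⟩
    have hx : (x, x) ∈ (partialId (Set.univ : Set X)).graph := ⟨trivial, rfl⟩
    have hne : partialId (∅ : Set X) ≠ partialId Set.univ := by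
      intro h
      rw [← h] at hx
      exact hx.1
    exact up _ (isOpen_compl_singleton (x := partialId (Set.univ : Set X)))
      (partialId ∅) (partialId Set.univ) (fun p hp => hp.1.elim) hne rfl
end

section
/- (I(X), τ₁) is a Hausdorff topological semigroup: the topology τ₁ is Hausdorff and composition I(X) × I(X) → I(X) is jointly τ₁-continuous. -/
open TopologicalSpace Filter

open PartialBij in
/-- `(I(X), τ₁)` is a Hausdorff topological semigroup. -/
theorem tau1_hausdorff_topological_semigroup (X : Type*) :
    @T2Space (PartialBij X) (tau1 X) ∧
    @Continuous (PartialBij X × PartialBij X) (PartialBij X)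
      (@instTopologicalSpaceProd _ _ (tau1 X) (tau1 X)) (tau1 X)
      (fun p => p.1.comp p.2) := by
  letI : TopologicalSpace (PartialBij X) := tau1 X
  have hv : ∀ x y : X, IsOpen (v x y) := fun x y =>
    isOpen_generateFrom_of_mem (Or.inl ⟨x, y, rfl⟩)
  have hw : ∀ x : X, IsOpen (w1 x) := fun x =>
    isOpen_generateFrom_of_mem (Or.inr ⟨x, rfl⟩)
  have hvc : ∀ x y : X, IsOpen (v x y)ᶜ := by
    intro x y
    have : (v x y)ᶜ = w1 x ∪ ⋃ y' ∈ {y' : X | y' ≠ y}, v x y' := by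
      ext f
      simp only [v, w1, dom, Set.mem_compl_iff, Set.mem_setOf_eq, Set.mem_union,
        Set.mem_iUnion, exists_prop]
      constructor
      · intro h
        by_cases hd : ∃ z, (x, z) ∈ f.graph
        · obtain ⟨z, hz⟩ := hd
          exact Or.inr ⟨z, fun e => h (e ▸ hz), hz⟩
        · exact Or.inl hd
      · rintro (h | ⟨z, hne, hz⟩) hy
        · exact h ⟨y, hy⟩
        · exact hne (f.functional hz hy)
    rw [this]
    exact (hw x).union (isOpen_biUnion fun y' _ => hv x y')
  refine ⟨⟨fun f g hfg => ?_⟩, continuous_generateFrom_iff.2 ?_⟩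
  · have hne : f.graph ≠ g.graph := by
      intro h
      cases f
      cases g
      simp only at h
      subst h
      exact hfg rfl
    have : ∃ p : X × X, ¬ (p ∈ f.graph ↔ p ∈ g.graph) := by
      by_contra hcon
      push Not at hcon
      exact hne (Set.ext hcon)
    obtain ⟨⟨x, y⟩, hp⟩ := this
    by_cases hf : (x, y) ∈ f.graph
    · have hg : (x, y) ∉ g.graph := fun hg => hp ⟨fun _ => hg, fun _ => hf⟩
      exact ⟨v x y, (v x y)ᶜ, hv x y, hvc x y, hf, hg, disjoint_compl_right⟩
    · have hg : (x, y) ∈ g.graph := by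
        by_contra hg
        exact hp ⟨fun h => absurd h hf, fun h => absurd h hg⟩
      exact ⟨(v x y)ᶜ, v x y, hvc x y, hv x y, hf, hg, disjoint_compl_left⟩
  · rintro s (⟨x, y, rfl⟩ | ⟨x, rfl⟩)
    · have : (fun p : PartialBij X × PartialBij X => p.1.comp p.2) ⁻¹' (v x y)
          = ⋃ z : X, (v z y) ×ˢ (v x z) := by
        ext ⟨f, g⟩
        simp only [v, comp, Set.mem_preimage, Set.mem_setOf_eq, Set.mem_iUnion, Set.mem_prod]
        exact exists_congr fun z => and_comm
      rw [this]
      exact isOpen_iUnion fun z => (hv z y).prod (hv x z)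
    · have : (fun p : PartialBij X × PartialBij X => p.1.comp p.2) ⁻¹' (w1 x)
          = (Set.univ ×ˢ w1 x) ∪ ⋃ z : X, (w1 z) ×ˢ (v x z) := by
        ext ⟨f, g⟩
        simp only [v, w1, dom, comp, Set.mem_preimage, Set.mem_setOf_eq, Set.mem_iUnion,
          Set.mem_prod, Set.mem_union, Set.mem_univ, true_and]
        constructor
        · intro h
          by_cases hd : ∃ z, (x, z) ∈ g.graph
          · obtain ⟨z, hz⟩ := hd
            exact Or.inr ⟨z, fun ⟨y, hy⟩ => h ⟨y, z, hz, hy⟩, hz⟩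
          · exact Or.inl hd
        · rintro (h | ⟨z, hz, hxz⟩) ⟨y, z', h1, h2⟩
          · exact h ⟨z', h1⟩
          · obtain rfl := g.functional hxz h1
            exact hz ⟨y, h2⟩
      rw [this]
      exact (isOpen_univ.prod (hw x)).union (isOpen_iUnion fun z => (hw z).prod (hv x z))
end

section
/- (I(X), τ_pp) is a Hausdorff topological inverse semigroup: τ_pp is Hausdorff, composition I(X) × I(X) → I(X) is jointly τ_pp-continuous, and the inversion map f ↦ f⁻¹ is τ_pp-continuous. -/
open TopologicalSpace Filter

open PartialBij in
/-- `(I(X), τ_pp)` is a Hausdorff topological inverse semigroup. -/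
theorem taupp_hausdorff_topological_inverse_semigroup (X : Type*) :
    @T2Space (PartialBij X) (taupp X) ∧
    @Continuous (PartialBij X × PartialBij X) (PartialBij X)
      (@instTopologicalSpaceProd _ _ (taupp X) (taupp X)) (taupp X)
      (fun p => p.1.comp p.2) ∧
    @Continuous (PartialBij X) (PartialBij X) (taupp X) (taupp X) inv := by
  letI : TopologicalSpace (PartialBij X) := taupp X
  have hv : ∀ x y : X, IsOpen (v x y) := fun x y =>
    isOpen_generateFrom_of_mem (Or.inl (Or.inl ⟨x, y, rfl⟩))
  have hw1 : ∀ x : X, IsOpen (w1 x) := fun x =>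
    isOpen_generateFrom_of_mem (Or.inl (Or.inr ⟨x, rfl⟩))
  have hw2 : ∀ y : X, IsOpen (w2 y) := fun y =>
    isOpen_generateFrom_of_mem (Or.inr ⟨y, rfl⟩)
  have key : ∀ (f g : PartialBij X) (x y : X), (x, y) ∈ f.graph → (x, y) ∉ g.graph →
      ∃ u : Set (PartialBij X), IsOpen u ∧ g ∈ u ∧ Disjoint (v x y) u := by
    intro f g x y hf hg
    by_cases hx : ∃ z, (x, z) ∈ g.graph
    · obtain ⟨z, hz⟩ := hx
      refine ⟨v x z, hv x z, hz, Set.disjoint_left.2 fun k hk hk' => hg ?_⟩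
      obtain rfl := k.functional hk hk'
      exact hz
    · exact ⟨w1 x, hw1 x, hx, Set.disjoint_left.2 fun k hk hk' => hk' ⟨y, hk⟩⟩
  refine ⟨⟨?_⟩, ?_, ?_⟩
  · intro f g hfg
    by_cases h1 : f.graph ⊆ g.graph
    · by_cases h2 : g.graph ⊆ f.graph
      · exfalso
        apply hfg
        cases f
        cases g
        obtain rfl := Set.Subset.antisymm h1 h2
        rfl
      · obtain ⟨⟨x, y⟩, hg, hf⟩ := Set.not_subset.1 h2
        obtain ⟨u, hu, hfu, hd⟩ := key g f x y hg hf
        exact ⟨u, v x y, hu, hv x y, hfu, hg, hd.symm⟩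
    · obtain ⟨⟨x, y⟩, hf, hg⟩ := Set.not_subset.1 h1
      obtain ⟨u, hu, hgu, hd⟩ := key f g x y hf hg
      exact ⟨v x y, u, hv x y, hu, hf, hgu, hd⟩
  · refine continuous_generateFrom_iff.2 ?_
    rintro s ((⟨x, y, rfl⟩ | ⟨x, rfl⟩) | ⟨y, rfl⟩)
    · have : (fun p : PartialBij X × PartialBij X => p.1.comp p.2) ⁻¹' v x y =
          ⋃ z, v z y ×ˢ v x z := by
        ext ⟨f, g⟩
        simp [v, comp, and_comm]
      rw [this]
      exact isOpen_iUnion fun z => (hv z y).prod (hv x z)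
    · have : (fun p : PartialBij X × PartialBij X => p.1.comp p.2) ⁻¹' w1 x =
          (Set.univ ×ˢ w1 x) ∪ ⋃ z, w1 z ×ˢ v x z := by
        ext ⟨f, g⟩
        simp only [v, w1, comp, dom, Set.mem_preimage, Set.mem_setOf_eq, Set.mem_union,
          Set.mem_prod, Set.mem_univ, true_and, Set.mem_iUnion]
        constructor
        · intro h
          by_cases hx : ∃ z, (x, z) ∈ g.graph
          · obtain ⟨z, hz⟩ := hx
            exact Or.inr ⟨z, fun ⟨t, ht⟩ => h ⟨t, z, hz, ht⟩, hz⟩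
          · exact Or.inl hx
        · rintro (h | ⟨z, hz, hxz⟩) ⟨t, z', h1, h2⟩
          · exact h ⟨z', h1⟩
          · obtain rfl := g.functional hxz h1
            exact hz ⟨t, h2⟩
      rw [this]
      exact (isOpen_univ.prod (hw1 x)).union
        (isOpen_iUnion fun z => (hw1 z).prod (hv x z))
    · have : (fun p : PartialBij X × PartialBij X => p.1.comp p.2) ⁻¹' w2 y =
          (w2 y ×ˢ Set.univ) ∪ ⋃ z, v z y ×ˢ w2 z := by
        ext ⟨f, g⟩
        simp only [v, w2, comp, im, Set.mem_preimage, Set.mem_setOf_eq, Set.mem_union,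
          Set.mem_prod, Set.mem_univ, and_true, Set.mem_iUnion]
        constructor
        · intro h
          by_cases hy : ∃ z, (z, y) ∈ f.graph
          · obtain ⟨z, hz⟩ := hy
            exact Or.inr ⟨z, hz, fun ⟨t, ht⟩ => h ⟨t, z, ht, hz⟩⟩
          · exact Or.inl hy
        · rintro (h | ⟨z, hzy, hz⟩) ⟨t, z', h1, h2⟩
          · exact h ⟨z', h2⟩
          · obtain rfl := f.coinjective hzy h2
            exact hz ⟨t, h1⟩
      rw [this]
      exact ((hw2 y).prod isOpen_univ).union
        (isOpen_iUnion fun z => (hv z y).prod (hw2 z))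
  · refine continuous_generateFrom_iff.2 ?_
    rintro s ((⟨x, y, rfl⟩ | ⟨x, rfl⟩) | ⟨y, rfl⟩)
    · exact hv y x
    · exact hw2 x
    · exact hw1 y
end

section
/- Let τ be a topology on I(X) such that (I(X), τ) is a T₁ topological semigroup. Then for all x, y ∈ X the set v(x,y) is τ-clopen, and the sets w₁(x) and w₂(y) are τ-closed. -/
open TopologicalSpace Filter

/-- Two partial bijections with the same graph are equal. -/
theorem PartialBij.ext_graph {X : Type*} {f g : PartialBij X} (h : f.graph = g.graph) : f = g := by
  cases f; cases g; cases h; rfl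

open PartialBij in
/-- If `τ` is a `T₁` semigroup topology on `I(X)`, then each `v x y` is clopen and
each `w₁ x`, `w₂ y` is closed. -/
theorem v_clopen_w_closed_of_T1 {X : Type*} (τ : TopologicalSpace (PartialBij X))
    (hT1 : @T1Space (PartialBij X) τ)
    (hmul : @Continuous (PartialBij X × PartialBij X) (PartialBij X)
      (@instTopologicalSpaceProd _ _ τ τ) τ (fun p => p.1.comp p.2)) :
    ∀ x y : X,
      @IsClopen (PartialBij X) τ (v x y) ∧
      @IsClosed (PartialBij X) τ (w1 x) ∧
      @IsClosed (PartialBij X) τ (w2 y) := by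
  intro x y
  let E : PartialBij X := ⟨∅, by simp, by simp⟩
  let S : PartialBij X := ⟨{(x, y)}, by simp +contextual, by simp +contextual⟩
  have hr : ∀ g : PartialBij X, Continuous (fun f : PartialBij X => f.comp g) := fun g =>
    hmul.comp (continuous_id.prodMk continuous_const)
  have hl : ∀ g : PartialBij X, Continuous (fun f : PartialBij X => g.comp f) := fun g =>
    hmul.comp (continuous_const.prodMk continuous_id)
  let F : PartialBij X → PartialBij X := fun f => (partialId {y}).comp (f.comp (partialId {x}))
  have hF : Continuous F := (hl (partialId {y})).comp (hr (partialId {x}))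
  have hFm : ∀ f a b, (a, b) ∈ (F f).graph ↔ a = x ∧ b = y ∧ (x, y) ∈ f.graph := by
    intro f a b
    constructor
    · rintro ⟨c, ⟨d, ⟨h1, h2⟩, h3⟩, h4, h5⟩
      simp only [Set.mem_singleton_iff] at h1 h2 h3 h4 h5
      subst h2 h5 h1 h4
      exact ⟨rfl, rfl, h3⟩
    · rintro ⟨rfl, rfl, h⟩
      exact ⟨b, ⟨a, ⟨rfl, rfl⟩, h⟩, rfl, rfl⟩
  have h1 : v x y = F ⁻¹' {S} := by
    ext f
    constructor
    · intro h
      refine ext_graph ?_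
      ext ⟨a, b⟩
      rw [hFm]
      have h' : (x, y) ∈ f.graph := h
      simp [S, h']
    · intro h
      have h' : F f = S := h
      have : (x, y) ∈ (F f).graph := by rw [h']; simp [S]
      exact ((hFm f x y).1 this).2.2
  have h2 : (v x y)ᶜ = F ⁻¹' {E} := by
    ext f
    constructor
    · intro h
      refine ext_graph ?_
      ext ⟨a, b⟩
      rw [hFm]
      have h' : (x, y) ∉ f.graph := h
      simp [E, h']
    · intro h hv
      have h' : F f = E := h
      have : (x, y) ∈ (F f).graph := (hFm f x y).2 ⟨rfl, rfl, hv⟩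
      rw [h'] at this
      exact this
  have h3 : w1 x = (fun f : PartialBij X => f.comp (partialId {x})) ⁻¹' {E} := by
    ext f
    constructor
    · intro h
      refine ext_graph ?_
      ext ⟨a, b⟩
      refine ⟨?_, fun h => h.elim⟩
      rintro ⟨c, ⟨ha, hc⟩, hb⟩
      simp only [Set.mem_singleton_iff] at ha hc hb
      subst hc ha
      exact h ⟨b, hb⟩
    · rintro h ⟨b, hb⟩
      have h' : f.comp (partialId {x}) = E := h
      have : (x, b) ∈ (f.comp (partialId {x})).graph := ⟨x, ⟨rfl, rfl⟩, hb⟩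
      rw [h'] at this
      exact this
  have h4 : w2 y = (fun f : PartialBij X => (partialId {y}).comp f) ⁻¹' {E} := by
    ext f
    constructor
    · intro h
      refine ext_graph ?_
      ext ⟨a, b⟩
      refine ⟨?_, fun h => h.elim⟩
      rintro ⟨c, ha, hc, hb⟩
      simp only [Set.mem_singleton_iff] at ha hc hb
      subst hb hc
      exact h ⟨a, ha⟩
    · rintro h ⟨a, ha⟩
      have h' : (partialId {y}).comp f = E := h
      have : (a, y) ∈ ((partialId {y}).comp f).graph := ⟨y, ha, rfl, rfl⟩
      rw [h'] at this
      exact this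
  refine ⟨⟨?_, ?_⟩, ?_, ?_⟩
  · rw [h1]; exact isClosed_singleton.preimage hF
  · rw [← isClosed_compl_iff, h2]; exact isClosed_singleton.preimage hF
  · rw [h3]; exact isClosed_singleton.preimage (hr _)
  · rw [h4]; exact isClosed_singleton.preimage (hl _)
end

section
/- Let τ be a topology on I(X) such that (I(X), τ) is a T₁ topological inverse semigroup (composition and inversion f ↦ f⁻¹ are τ-continuous). Then the extension relation {(f,g) : f ⊆ g} is closed in I(X) × I(X) (with the product of τ with itself) if and only if w₁(x) is τ-open for every x ∈ X. -/
open TopologicalSpace Filter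

namespace PartialBij

theorem isOpen_v_aux {X : Type*} [TopologicalSpace (PartialBij X)] [T1Space (PartialBij X)]
    (hmul : Continuous (fun p : PartialBij X × PartialBij X => p.1.comp p.2)) (x y : X) :
    IsOpen (v x y) := by
  have hc : Continuous (fun f : PartialBij X =>
      (partialId {y}).comp (f.comp (partialId {x}))) := by
    have h1 : Continuous (fun f : PartialBij X => f.comp (partialId {x})) :=
      hmul.comp (continuous_id.prodMk continuous_const)
    exact hmul.comp (continuous_const.prodMk h1)
  have he : v x y = (fun f : PartialBij X =>
      (partialId {y}).comp (f.comp (partialId {x}))) ⁻¹' {partialId ∅}ᶜ := by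
    ext f
    constructor
    · intro hf h
      have h' := congrArg graph (Set.mem_singleton_iff.1 h)
      have hm : (x, y) ∈ ((partialId {y}).comp (f.comp (partialId {x}))).graph :=
        ⟨y, ⟨x, ⟨rfl, rfl⟩, hf⟩, ⟨rfl, rfl⟩⟩
      rw [h'] at hm
      exact hm.1
    · intro h
      by_contra hf
      apply h
      have key : ((partialId {y}).comp (f.comp (partialId {x}))).graph
          = (partialId (∅ : Set X)).graph := by
        ext ⟨a, b⟩
        constructor
        · rintro ⟨c, ⟨d, ⟨h1, h2⟩, h3⟩, ⟨h4, h5⟩⟩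
          simp only [Set.mem_singleton_iff] at h1 h2 h3 h4 h5
          subst h1 h2 h4
          exact (hf h3).elim
        · rintro ⟨h1, _⟩
          exact h1.elim
      have ext' : ∀ a b : PartialBij X, a.graph = b.graph → a = b := by
        rintro ⟨a, _, _⟩ ⟨b, _, _⟩ h
        cases h
        rfl
      exact ext' _ _ key
  rw [he]
  exact isOpen_compl_singleton.preimage hc

end PartialBij

open PartialBij in
/-- If `τ` is a `T₁` inverse semigroup topology on `I(X)`, then the extension
relation `⊆` is closed in `I(X) × I(X)` iff every `w₁ x` is open. -/
theorem extension_closed_iff_w1_open {X : Type*} (τ : TopologicalSpace (PartialBij X))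
    (hT1 : @T1Space (PartialBij X) τ)
    (hmul : @Continuous (PartialBij X × PartialBij X) (PartialBij X)
      (@instTopologicalSpaceProd _ _ τ τ) τ (fun p => p.1.comp p.2))
    (hinv : @Continuous (PartialBij X) (PartialBij X) τ τ inv) :
    @IsClosed (PartialBij X × PartialBij X) (@instTopologicalSpaceProd _ _ τ τ)
        {p : PartialBij X × PartialBij X | p.1.graph ⊆ p.2.graph} ↔
      ∀ x : X, @IsOpen (PartialBij X) τ (w1 x) := by
  letI := τ
  haveI := hT1
  have hv := isOpen_v_aux hmul
  constructor
  · intro hcl x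
    have hc : Continuous (fun f : PartialBij X => (partialId {x}, (inv f).comp f)) :=
      continuous_const.prodMk (hmul.comp (hinv.prodMk continuous_id))
    have he : w1 x = ((fun f : PartialBij X => (partialId {x}, (inv f).comp f)) ⁻¹'
        {p : PartialBij X × PartialBij X | p.1.graph ⊆ p.2.graph})ᶜ := by
      ext f
      constructor
      · intro hf h
        obtain ⟨y, hy, _⟩ := h (show (x, x) ∈ (partialId {x}).graph from ⟨rfl, rfl⟩)
        exact hf ⟨y, hy⟩
      · rintro h ⟨y, hy⟩
        apply h
        rintro ⟨a, b⟩ ⟨h1, h2⟩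
        simp only [Set.mem_singleton_iff] at h1 h2
        subst h1 h2
        exact ⟨y, hy, hy⟩
    rw [he]
    exact (hcl.preimage hc).isOpen_compl
  · intro hw
    rw [← isOpen_compl_iff, isOpen_iff_mem_nhds]
    rintro ⟨f, g⟩ hfg
    obtain ⟨⟨x, y⟩, hf, hg⟩ := Set.not_subset.1 hfg
    by_cases hx : x ∈ g.dom
    · obtain ⟨z, hz⟩ := hx
      filter_upwards [((hv x y).prod (hv x z)).mem_nhds ⟨hf, hz⟩]
      rintro ⟨f', g'⟩ ⟨h1, h2⟩ h
      have := g'.functional (h h1) h2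
      subst this
      exact hg hz
    · filter_upwards [((hv x y).prod (hw x)).mem_nhds ⟨hf, hx⟩]
      rintro ⟨f', g'⟩ ⟨h1, h2⟩ h
      exact h2 ⟨y, h h1⟩
end

section
/- If τ is a Hausdorff inverse semigroup topology on I(X) (composition is jointly τ-continuous and inversion f ↦ f⁻¹ is τ-continuous), then τ_pp ⊆ τ. In other words, τ_pp is the minimal Hausdorff inverse semigroup topology on I(X). -/
open TopologicalSpace Filter

open PartialBij in
/-- `τ_pp` is the minimal Hausdorff inverse semigroup topology on `I(X)`:
every `τ_pp`-open set is open in any Hausdorff inverse semigroup topology `τ`. -/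
theorem taupp_minimal {X : Type*} (τ : TopologicalSpace (PartialBij X))
    (hT2 : @T2Space (PartialBij X) τ)
    (hmul : @Continuous (PartialBij X × PartialBij X) (PartialBij X)
      (@instTopologicalSpaceProd _ _ τ τ) τ (fun p => p.1.comp p.2))
    (hinv : @Continuous (PartialBij X) (PartialBij X) τ τ inv) :
    ∀ s : Set (PartialBij X), @IsOpen (PartialBij X) (taupp X) s →
      @IsOpen (PartialBij X) τ s := by
  have hc : ∀ a b : PartialBij X → PartialBij X, Continuous a → Continuous b →
      Continuous (fun f => (a f).comp (b f)) := fun a b ha hb => hmul.comp (ha.prodMk hb)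
  have hw1 : ∀ x : X, IsOpen (w1 x) := by
    intro x
    have hcont : Continuous (fun f : PartialBij X => f.inv.comp (f.comp (partialId {x}))) :=
      hc _ _ hinv (hc _ _ continuous_id continuous_const)
    have h := (isClosed_singleton (x := (partialId {x} : PartialBij X))).isOpen_compl.preimage hcont
    convert h using 1
    ext f
    simp only [w1, Set.mem_setOf_eq, Set.mem_preimage, Set.mem_compl_iff, Set.mem_singleton_iff]
    refine not_congr ⟨?_, ?_⟩
    · rintro ⟨y, hy⟩
      have hg : (f.inv.comp (f.comp (partialId {x}))).graph = (partialId {x} : PartialBij X).graph := by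
        ext ⟨a, b⟩
        constructor
        · rintro ⟨z, ⟨t, ⟨h1, h2⟩, h3⟩, h4⟩
          dsimp only at h1 h2 h3
          subst h2
          exact ⟨h1, f.coinjective h3 h4⟩
        · rintro ⟨h1, h2⟩
          dsimp only at h2
          subst h2
          obtain rfl : a = x := h1
          exact ⟨y, ⟨a, ⟨rfl, rfl⟩, hy⟩, hy⟩
      generalize f.inv.comp (f.comp (partialId {x})) = p at hg
      cases p
      simp only [partialId] at hg ⊢
      subst hg
      rfl
    · intro he
      have hm : (x, x) ∈ (partialId {x} : PartialBij X).graph := ⟨rfl, rfl⟩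
      rw [← he] at hm
      obtain ⟨z, _, h4⟩ := hm
      exact ⟨z, h4⟩
  have hle : τ ≤ taupp X := by
    refine le_generateFrom ?_
    rintro s ((⟨x, y, rfl⟩ | ⟨x, rfl⟩) | ⟨y, rfl⟩)
    · have hcont : Continuous
          (fun f : PartialBij X => (partialId {y}).comp (f.comp (partialId {x}))) :=
        hc _ _ continuous_const (hc _ _ continuous_id continuous_const)
      have h := (isClosed_singleton (x := (partialId ∅ : PartialBij X))).isOpen_compl.preimage hcont
      convert h using 1
      ext f
      simp only [v, Set.mem_setOf_eq, Set.mem_preimage, Set.mem_compl_iff, Set.mem_singleton_iff]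
      constructor
      · intro hf he
        have hm : (x, y) ∈ ((partialId {y}).comp (f.comp (partialId {x}))).graph :=
          ⟨y, ⟨x, ⟨rfl, rfl⟩, hf⟩, ⟨rfl, rfl⟩⟩
        rw [he] at hm
        exact hm.1
      · intro hne
        by_contra hf
        apply hne
        have hg : ((partialId {y}).comp (f.comp (partialId {x}))).graph =
            (partialId ∅ : PartialBij X).graph := by
          ext ⟨a, b⟩
          constructor
          · rintro ⟨z, ⟨t, ⟨h1, h2⟩, h3⟩, h4, h5⟩
            dsimp only at h1 h2 h3 h4 h5
            obtain rfl : a = x := h1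
            obtain rfl : z = y := h4
            subst h2
            exact absurd h3 hf
          · rintro ⟨h1, _⟩
            exact h1.elim
        generalize (partialId {y}).comp (f.comp (partialId {x})) = p at hg
        cases p
        simp only [partialId] at hg ⊢
        subst hg
        rfl
    · exact hw1 x
    · exact (hw1 y).preimage hinv
  exact hle
end

section
/- The topological space (I(X), τ_pp) is regular. -/
open TopologicalSpace Filter

open PartialBij in
/-- `(I(X), τ_pp)` is a regular topological space. -/
theorem taupp_regular (X : Type*) : @RegularSpace (PartialBij X) (taupp X) := by
  letI := taupp X
  have hv : ∀ x y : X, IsOpen (v x y) := fun x y =>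
    isOpen_generateFrom_of_mem (Or.inl (Or.inl ⟨x, y, rfl⟩))
  have h1 : ∀ x : X, IsOpen (w1 x) := fun x =>
    isOpen_generateFrom_of_mem (Or.inl (Or.inr ⟨x, rfl⟩))
  have h2 : ∀ x : X, IsOpen (w2 x) := fun x =>
    isOpen_generateFrom_of_mem (Or.inr ⟨x, rfl⟩)
  have cv : ∀ x y : X, IsClosed (v x y) := by
    intro x y
    rw [← isOpen_compl_iff]
    have : (v x y)ᶜ = w1 x ∪ ⋃ (z : X) (_ : z ≠ y), v x z := by
      ext f
      simp only [v, w1, dom, Set.mem_compl_iff, Set.mem_setOf_eq, Set.mem_union,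
        Set.mem_iUnion, exists_prop]
      constructor
      · intro h
        by_cases hx : ∃ z, (x, z) ∈ f.graph
        · obtain ⟨z, hz⟩ := hx
          exact Or.inr ⟨z, fun e => h (e ▸ hz), hz⟩
        · exact Or.inl hx
      · rintro (h | ⟨z, hz, hf⟩) h'
        · exact h ⟨y, h'⟩
        · exact hz (f.functional hf h')
    rw [this]
    exact (h1 x).union (isOpen_iUnion fun z => isOpen_iUnion fun _ => hv x z)
  have c1 : ∀ x : X, IsClosed (w1 x) := by
    intro x
    rw [← isOpen_compl_iff]
    have : (w1 x)ᶜ = ⋃ z : X, v x z := by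
      ext f
      simp [v, w1, dom]
    rw [this]
    exact isOpen_iUnion fun z => hv x z
  have c2 : ∀ x : X, IsClosed (w2 x) := by
    intro x
    rw [← isOpen_compl_iff]
    have : (w2 x)ᶜ = ⋃ z : X, v z x := by
      ext f
      simp [v, w2, im]
    rw [this]
    exact isOpen_iUnion fun z => hv z x
  have key : ∀ U : Set (PartialBij X), IsOpen U → ∀ f ∈ U, ∃ C, IsClopen C ∧ f ∈ C ∧ C ⊆ U := by
    intro U hU
    induction hU with
    | basic s hs =>
      intro f hf
      refine ⟨s, ?_, hf, subset_rfl⟩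
      rcases hs with (⟨x, y, rfl⟩ | ⟨x, rfl⟩) | ⟨x, rfl⟩
      · exact ⟨cv x y, hv x y⟩
      · exact ⟨c1 x, h1 x⟩
      · exact ⟨c2 x, h2 x⟩
    | univ => exact fun f _ => ⟨Set.univ, isClopen_univ, trivial, subset_rfl⟩
    | inter s t _ _ hs ht =>
      intro f hf
      obtain ⟨C, hC, hfC, hCs⟩ := hs f hf.1
      obtain ⟨D, hD, hfD, hDt⟩ := ht f hf.2
      exact ⟨C ∩ D, hC.inter hD, ⟨hfC, hfD⟩, Set.inter_subset_inter hCs hDt⟩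
    | sUnion S _ ih =>
      rintro f ⟨s, hs, hf⟩
      obtain ⟨C, hC, hfC, hCs⟩ := ih s hs f hf
      exact ⟨C, hC, hfC, hCs.trans (Set.subset_sUnion_of_mem hs)⟩
  refine RegularSpace.of_exists_mem_nhds_isClosed_subset fun f s hs => ?_
  obtain ⟨U, hUs, hU, hf⟩ := mem_nhds_iff.1 hs
  obtain ⟨C, hC, hfC, hCU⟩ := key U hU f hf
  exact ⟨C, hC.isOpen.mem_nhds hfC, hC.isClosed, hCU.trans hUs⟩
end

section
/- Let τ be a Hausdorff inverse semigroup topology on I(X). Then the map A ↦ 1_A from 2^X (with the product topology) to (I(X), τ) is continuous if and only if the set of idempotents {1_A : A ⊆ X} is τ-compact. -/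
open TopologicalSpace Filter

namespace PartialBij

theorem cantor_compact (X : Type*) : @CompactSpace (Set X) (cantorTop X) := by
  letI : TopologicalSpace (Set X) := cantorTop X
  have hc : Continuous (fun g : X → Bool => {x | g x = true}) := by
    refine continuous_generateFrom_iff.mpr ?_
    rintro s (⟨x, rfl⟩ | ⟨x, rfl⟩)
    · have hx : Continuous (fun g : X → Bool => g x) := continuous_apply x
      exact (isOpen_discrete {b : Bool | b = true}).preimage hx
    · have hx : Continuous (fun g : X → Bool => g x) := continuous_apply x
      exact (isOpen_discrete {b : Bool | ¬ b = true}).preimage hx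
  have hs : Function.Surjective (fun g : X → Bool => {x | g x = true}) := by
    classical
    intro A
    refine ⟨fun x => decide (x ∈ A), ?_⟩
    ext x
    simp
  exact hs.compactSpace hc

theorem cantor_t2 (X : Type*) : @T2Space (Set X) (cantorTop X) := by
  letI : TopologicalSpace (Set X) := cantorTop X
  have h1 : ∀ x : X, IsOpen {A : Set X | x ∈ A} := fun x =>
    isOpen_generateFrom_of_mem (Or.inl ⟨x, rfl⟩)
  have h2 : ∀ x : X, IsOpen {A : Set X | x ∉ A} := fun x =>
    isOpen_generateFrom_of_mem (Or.inr ⟨x, rfl⟩)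
  refine ⟨fun A B hAB => ?_⟩
  have : ∃ x, ¬ (x ∈ A ↔ x ∈ B) := by
    by_contra hh
    push Not at hh
    exact hAB (Set.ext hh)
  obtain ⟨x, hx⟩ := this
  by_cases hA : x ∈ A
  · exact ⟨_, _, h1 x, h2 x, hA, fun hB => hx ⟨fun _ => hB, fun _ => hA⟩,
      Set.disjoint_left.mpr fun _ h h' => h' h⟩
  · refine ⟨_, _, h2 x, h1 x, hA, ?_, Set.disjoint_left.mpr fun _ h h' => h h'⟩
    by_contra hB
    exact hx ⟨fun h => absurd h hA, fun h => absurd h hB⟩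

theorem partialId_inj {X : Type*} :
    Function.Injective (partialId : Set X → PartialBij X) := by
  intro A B h
  have hg : (partialId A).graph = (partialId B).graph := by rw [h]
  ext x
  have := Set.ext_iff.mp hg (x, x)
  simpa [partialId] using this

theorem comp_partialId {X : Type*} (A B : Set X) :
    (partialId A).comp (partialId B) = partialId (A ∩ B) := by
  simp only [comp, partialId, PartialBij.mk.injEq]
  ext ⟨x, y⟩
  simp only [Set.mem_ofPred_eq, Set.mem_inter_iff]
  constructor
  · rintro ⟨z, ⟨h1, rfl⟩, h2, rfl⟩
    exact ⟨⟨h2, h1⟩, rfl⟩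
  · rintro ⟨⟨h2, h1⟩, rfl⟩
    exact ⟨x, ⟨h1, rfl⟩, h2, rfl⟩

end PartialBij

open PartialBij in
/-- For a Hausdorff inverse semigroup topology `τ` on `I(X)`, the map `A ↦ 1_A`
from `2^X` (product topology) to `(I(X), τ)` is continuous iff the set of
idempotents `{1_A : A ⊆ X}` is `τ`-compact. -/
theorem partialId_continuous_iff_idempotents_compact {X : Type*}
    (τ : TopologicalSpace (PartialBij X))
    (hT2 : @T2Space (PartialBij X) τ)
    (hmul : @Continuous (PartialBij X × PartialBij X) (PartialBij X)
      (@instTopologicalSpaceProd _ _ τ τ) τ (fun p => p.1.comp p.2))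
    (hinv : @Continuous (PartialBij X) (PartialBij X) τ τ inv) :
    @Continuous (Set X) (PartialBij X) (cantorTop X) τ partialId ↔
      @IsCompact (PartialBij X) τ (Set.range (partialId : Set X → PartialBij X)) := by
  letI : TopologicalSpace (Set X) := cantorTop X
  constructor
  · intro h
    haveI : CompactSpace (Set X) := cantor_compact X
    exact isCompact_range h
  · intro hK
    haveI : T2Space (Set X) := cantor_t2 X
    haveI : CompactSpace (Set.range (partialId : Set X → PartialBij X)) :=
      isCompact_iff_compactSpace.mp hK
    let e : Set X ≃ Set.range (partialId : Set X → PartialBij X) :=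
      Equiv.ofInjective _ partialId_inj
    have hcl : ∀ x : X, ∀ B : Set X, IsClosed
        {f : Set.range (partialId : Set X → PartialBij X) |
          (partialId {x}).comp f.1 = partialId B} := by
      intro x B
      have hc : Continuous (fun f : Set.range (partialId : Set X → PartialBij X) =>
          (partialId {x}).comp f.1) :=
        hmul.comp (continuous_const.prodMk continuous_subtype_val)
      exact isClosed_eq hc continuous_const
    have hval : ∀ f : Set.range (partialId : Set X → PartialBij X),
        f.1 = partialId (e.symm f) := by
      intro f
      exact (congrArg Subtype.val (e.apply_symm_apply f)).symm
    have hcont : Continuous e.symm := by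
      refine continuous_generateFrom_iff.mpr ?_
      rintro s (⟨x, rfl⟩ | ⟨x, rfl⟩)
      · rw [← isClosed_compl_iff]
        convert hcl x ∅ using 1
        ext f
        simp only [Set.mem_compl_iff, Set.mem_preimage, Set.mem_ofPred_eq]
        rw [hval f, comp_partialId, partialId_inj.eq_iff, Set.singleton_inter_eq_empty]
      · rw [← isClosed_compl_iff]
        convert hcl x {x} using 1
        ext f
        simp only [Set.mem_compl_iff, Set.mem_preimage, Set.mem_ofPred_eq, not_not]
        rw [hval f, comp_partialId, partialId_inj.eq_iff, Set.inter_eq_left,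
          Set.singleton_subset_iff]
    have h2 : Continuous e :=
      Continuous.continuous_symm_of_equiv_compact_to_t2 (f := e.symm) hcont
    exact continuous_subtype_val.comp h2
end

section
/- For every y ∈ X the set w₂(y) is nowhere dense in (I(X), τ₁), and for every x ∈ X the set w₁(x) is nowhere dense in (I(X), τ₂). -/
open TopologicalSpace Filter

namespace PartialBij

theorem tau1_local {X : Type*} (U : Set (PartialBij X)) (hU : @IsOpen _ (tau1 X) U)
    (f : PartialBij X) (hf : f ∈ U) :
    ∃ F : Set X, F.Finite ∧ ∀ g : PartialBij X,
      (∀ a ∈ F, ∀ b, (a, b) ∈ f.graph ↔ (a, b) ∈ g.graph) → g ∈ U := by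
  induction hU with
  | basic s hs =>
    rcases hs with ⟨x, y, rfl⟩ | ⟨x, rfl⟩
    · exact ⟨{x}, Set.finite_singleton _, fun g hg => (hg _ rfl _).1 hf⟩
    · exact ⟨{x}, Set.finite_singleton _, fun g hg ⟨b, hb⟩ => hf ⟨b, (hg _ rfl _).2 hb⟩⟩
  | univ => exact ⟨∅, Set.finite_empty, fun _ _ => trivial⟩
  | inter s t _ _ ihs iht =>
    obtain ⟨F, hF, h⟩ := ihs hf.1
    obtain ⟨G, hG, k⟩ := iht hf.2
    exact ⟨F ∪ G, hF.union hG, fun g hg =>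
      ⟨h g fun a ha => hg a (Or.inl ha), k g fun a ha => hg a (Or.inr ha)⟩⟩
  | sUnion S _ ih =>
    obtain ⟨s, hs, hfs⟩ := hf
    obtain ⟨F, hF, h⟩ := ih s hs hfs
    exact ⟨F, hF, fun g hg => ⟨s, hs, h g hg⟩⟩

theorem w2_nowhereDense {X : Type*} [Infinite X] (y : X) :
    @IsNowhereDense (PartialBij X) (tau1 X) (w2 y) := by
  letI := tau1 X
  have hc : IsClosed (w2 y) := by
    rw [← isOpen_compl_iff]
    have : (w2 y)ᶜ = ⋃ x : X, v x y := by
      ext f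
      simp [w2, v, im]
    rw [this]
    exact isOpen_iUnion fun x => isOpen_generateFrom_of_mem (Or.inl ⟨_, _, rfl⟩)
  rw [hc.isNowhereDense_iff, Set.eq_empty_iff_forall_notMem]
  intro f hf
  obtain ⟨F, hF, h⟩ := tau1_local _ isOpen_interior f hf
  obtain ⟨c, hcF⟩ := hF.exists_notMem
  have hy : y ∉ f.im := interior_subset hf
  let g : PartialBij X :=
    { graph := {p | (p.1 ∈ F ∧ p ∈ f.graph) ∨ p = (c, y)}
      functional := by
        rintro a b b' (⟨h1, h2⟩ | h1) (⟨h3, h4⟩ | h3)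
        · exact f.functional h2 h4
        · simp only [Prod.mk.injEq] at h3
          obtain ⟨rfl, rfl⟩ := h3
          first | exact absurd h1 hcF | exact absurd ⟨_, h2⟩ hy
        · simp only [Prod.mk.injEq] at h1
          obtain ⟨rfl, rfl⟩ := h1
          first | exact absurd h3 hcF | exact absurd ⟨_, h4⟩ hy
        · grind
      coinjective := by
        rintro a a' b (⟨h1, h2⟩ | h1) (⟨h3, h4⟩ | h3)
        · exact f.coinjective h2 h4
        · simp only [Prod.mk.injEq] at h3
          obtain ⟨rfl, rfl⟩ := h3
          first | exact absurd h1 hcF | exact absurd ⟨_, h2⟩ hy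
        · simp only [Prod.mk.injEq] at h1
          obtain ⟨rfl, rfl⟩ := h1
          first | exact absurd h3 hcF | exact absurd ⟨_, h4⟩ hy
        · grind }
  have hg : g ∈ interior (w2 y) := by
    apply h
    intro a ha b
    constructor
    · intro hab
      exact Or.inl ⟨ha, hab⟩
    · rintro (⟨_, h2⟩ | h2)
      · exact h2
      · grind
  exact interior_subset hg ⟨c, Or.inr rfl⟩

theorem tau2_local {X : Type*} (U : Set (PartialBij X)) (hU : @IsOpen _ (tau2 X) U)
    (f : PartialBij X) (hf : f ∈ U) :
    ∃ F : Set X, F.Finite ∧ ∀ g : PartialBij X,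
      (∀ a ∈ F, ∀ b, (b, a) ∈ f.graph ↔ (b, a) ∈ g.graph) → g ∈ U := by
  induction hU with
  | basic s hs =>
    rcases hs with ⟨x, y, rfl⟩ | ⟨x, rfl⟩
    · exact ⟨{y}, Set.finite_singleton _, fun g hg => (hg _ rfl _).1 hf⟩
    · exact ⟨{x}, Set.finite_singleton _, fun g hg ⟨b, hb⟩ => hf ⟨b, (hg _ rfl _).2 hb⟩⟩
  | univ => exact ⟨∅, Set.finite_empty, fun _ _ => trivial⟩
  | inter s t _ _ ihs iht =>
    obtain ⟨F, hF, h⟩ := ihs hf.1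
    obtain ⟨G, hG, k⟩ := iht hf.2
    exact ⟨F ∪ G, hF.union hG, fun g hg =>
      ⟨h g fun a ha => hg a (Or.inl ha), k g fun a ha => hg a (Or.inr ha)⟩⟩
  | sUnion S _ ih =>
    obtain ⟨s, hs, hfs⟩ := hf
    obtain ⟨F, hF, h⟩ := ih s hs hfs
    exact ⟨F, hF, fun g hg => ⟨s, hs, h g hg⟩⟩

theorem w1_nowhereDense {X : Type*} [Infinite X] (y : X) :
    @IsNowhereDense (PartialBij X) (tau2 X) (w1 y) := by
  letI := tau2 X
  have hc : IsClosed (w1 y) := by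
    rw [← isOpen_compl_iff]
    have : (w1 y)ᶜ = ⋃ x : X, v y x := by
      ext f
      simp [w1, v, dom]
    rw [this]
    exact isOpen_iUnion fun x => isOpen_generateFrom_of_mem (Or.inl ⟨_, _, rfl⟩)
  rw [hc.isNowhereDense_iff, Set.eq_empty_iff_forall_notMem]
  intro f hf
  obtain ⟨F, hF, h⟩ := tau2_local _ isOpen_interior f hf
  obtain ⟨c, hcF⟩ := hF.exists_notMem
  have hy : y ∉ f.dom := interior_subset hf
  let g : PartialBij X :=
    { graph := {p | (p.2 ∈ F ∧ p ∈ f.graph) ∨ p = (y, c)}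
      functional := by
        rintro a b b' (⟨h1, h2⟩ | h1) (⟨h3, h4⟩ | h3)
        · exact f.functional h2 h4
        · simp only [Prod.mk.injEq] at h3
          obtain ⟨rfl, rfl⟩ := h3
          first | exact absurd h1 hcF | exact absurd ⟨_, h2⟩ hy
        · simp only [Prod.mk.injEq] at h1
          obtain ⟨rfl, rfl⟩ := h1
          first | exact absurd h3 hcF | exact absurd ⟨_, h4⟩ hy
        · grind
      coinjective := by
        rintro a a' b (⟨h1, h2⟩ | h1) (⟨h3, h4⟩ | h3)
        · exact f.coinjective h2 h4
        · simp only [Prod.mk.injEq] at h3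
          obtain ⟨rfl, rfl⟩ := h3
          first | exact absurd h1 hcF | exact absurd ⟨_, h2⟩ hy
        · simp only [Prod.mk.injEq] at h1
          obtain ⟨rfl, rfl⟩ := h1
          first | exact absurd h3 hcF | exact absurd ⟨_, h4⟩ hy
        · grind }
  have hg : g ∈ interior (w1 y) := by
    apply h
    intro a ha b
    constructor
    · intro hab
      exact Or.inl ⟨ha, hab⟩
    · rintro (⟨_, h2⟩ | h2)
      · exact h2
      · grind
  exact interior_subset hg ⟨c, Or.inr rfl⟩

end PartialBij

open PartialBij in
/-- Each `w₂ y` is nowhere dense in `(I(X), τ₁)` and each `w₁ x` is nowhere dense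
in `(I(X), τ₂)`. -/
theorem w2_w1_nowhere_dense {X : Type*} [Infinite X] :
    (∀ y : X, @IsNowhereDense (PartialBij X) (tau1 X) (w2 y)) ∧
    (∀ x : X, @IsNowhereDense (PartialBij X) (tau2 X) (w1 x)) := by
  exact ⟨fun y => w2_nowhereDense y, fun x => w1_nowhereDense x⟩
end

section
/- τ_pp is the smallest topology on I(X) such that the maps dom : I(X) → 2^X, im : I(X) → 2^X are continuous and, for each x ∈ X, the evaluation map ev_x : D_x → X, f ↦ f(x), is continuous on D_x with its subspace topology, where 2^X carries the product topology and X the discrete topology. -/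
open TopologicalSpace Filter

theorem PartialBij.evalAt_mem {X : Type*} {x : X} {f : PartialBij X} (h : x ∈ f.dom) :
    (x, PartialBij.evalAt x f) ∈ f.graph := by
  unfold PartialBij.evalAt
  rw [dif_pos h]
  exact h.choose_spec

theorem PartialBij.evalAt_eq_iff {X : Type*} {x y : X} {f : PartialBij X} (h : x ∈ f.dom) :
    PartialBij.evalAt x f = y ↔ (x, y) ∈ f.graph := by
  constructor
  · rintro rfl
    exact PartialBij.evalAt_mem h
  · intro h'
    exact f.functional (PartialBij.evalAt_mem h) h'

theorem PartialBij.isOpen_v {X : Type*} (x y : X) : @IsOpen _ (PartialBij.taupp X) (PartialBij.v x y) :=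
  isOpen_generateFrom_of_mem (Or.inl (Or.inl ⟨x, y, rfl⟩))

open PartialBij in
/-- `τ_pp` is the smallest topology on `I(X)` making `dom`, `im` (into `2^X` with
the product topology) continuous and each evaluation `ev_x : D_x → X` continuous
(`X` discrete, `D_x` with the subspace topology). -/
theorem taupp_smallest_making_projections_continuous (X : Type*) :
    (@Continuous (PartialBij X) (Set X) (taupp X) (cantorTop X) dom ∧
     @Continuous (PartialBij X) (Set X) (taupp X) (cantorTop X) im ∧
     ∀ x : X, @Continuous {f : PartialBij X // x ∈ f.dom} X
        (@instTopologicalSpaceSubtype _ _ (taupp X)) ⊥ (fun f => evalAt x f.1)) ∧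
    ∀ τ : TopologicalSpace (PartialBij X),
      (@Continuous (PartialBij X) (Set X) τ (cantorTop X) dom ∧
       @Continuous (PartialBij X) (Set X) τ (cantorTop X) im ∧
       ∀ x : X, @Continuous {f : PartialBij X // x ∈ f.dom} X
          (@instTopologicalSpaceSubtype _ _ τ) ⊥ (fun f => evalAt x f.1)) →
      ∀ s : Set (PartialBij X), @IsOpen (PartialBij X) (taupp X) s →
        @IsOpen (PartialBij X) τ s := by
  refine ⟨⟨?_, ?_, ?_⟩, ?_⟩
  · letI := taupp X
    refine continuous_generateFrom_iff.2 ?_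
    rintro s (⟨x, rfl⟩ | ⟨x, rfl⟩)
    · have : dom ⁻¹' {A : Set X | x ∈ A} = ⋃ y, v x y := by
        ext f; simp [dom, v]
      rw [this]
      exact isOpen_iUnion fun y => isOpen_v x y
    · exact isOpen_generateFrom_of_mem (Or.inl (Or.inr ⟨x, rfl⟩))
  · letI := taupp X
    refine continuous_generateFrom_iff.2 ?_
    rintro s (⟨x, rfl⟩ | ⟨x, rfl⟩)
    · have : im ⁻¹' {A : Set X | x ∈ A} = ⋃ y, v y x := by
        ext f; simp [im, v]
      rw [this]
      exact isOpen_iUnion fun y => isOpen_v y x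
    · exact isOpen_generateFrom_of_mem (Or.inr ⟨x, rfl⟩)
  · intro x
    letI := taupp X
    letI : TopologicalSpace X := ⊥
    haveI : DiscreteTopology X := ⟨rfl⟩
    refine continuous_discrete_rng.2 fun y => ?_
    refine ⟨v x y, isOpen_v x y, ?_⟩
    ext f
    exact (evalAt_eq_iff f.2).symm
  · rintro τ ⟨hd, hi, he⟩ s hs
    have hle : τ ≤ taupp X := by
      refine le_generateFrom ?_
      rintro s ((⟨x, y, rfl⟩ | ⟨x, rfl⟩) | ⟨y, rfl⟩)
      · letI : TopologicalSpace X := ⊥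
        haveI : DiscreteTopology X := ⟨rfl⟩
        obtain ⟨u, hu, hu'⟩ := continuous_discrete_rng.1 (he x) y
        have h1 : @IsOpen _ τ (dom ⁻¹' {A : Set X | x ∈ A}) :=
          continuous_generateFrom_iff.1 hd _ (Or.inl ⟨x, rfl⟩)
        have : v x y = u ∩ dom ⁻¹' {A : Set X | x ∈ A} := by
          ext f
          constructor
          · intro hf
            have hx : x ∈ f.dom := ⟨y, hf⟩
            have : (⟨f, hx⟩ : {f : PartialBij X // x ∈ f.dom}) ∈ Subtype.val ⁻¹' u := by
              rw [hu']
              exact (evalAt_eq_iff hx).2 hf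
            exact ⟨this, hx⟩
          · rintro ⟨hf, hx⟩
            have : (⟨f, hx⟩ : {f : PartialBij X // x ∈ f.dom}) ∈ Subtype.val ⁻¹' u := hf
            rw [hu'] at this
            exact (evalAt_eq_iff hx).1 this
        rw [this]
        exact hu.inter h1
      · exact continuous_generateFrom_iff.1 hd _ (Or.inr ⟨x, rfl⟩)
      · exact continuous_generateFrom_iff.1 hi _ (Or.inr ⟨y, rfl⟩)
    exact hle s hs
end

section
/- The maps dom : (I(X), τ_pp) → 2^X and im : (I(X), τ_pp) → 2^X are open maps, where 2^X carries the product topology. -/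
open TopologicalSpace Filter

open Topology

namespace PartialBij

theorem exists_finite_nhd {X : Type*} (U : Set (PartialBij X)) (hU : IsOpen[taupp X] U) :
    ∀ f ∈ U, ∃ F : Set X, F.Finite ∧ ∀ g : PartialBij X,
      (∀ x ∈ F, ∀ y, (x, y) ∈ f.graph → (x, y) ∈ g.graph) →
      (∀ x ∈ F, x ∉ f.dom → x ∉ g.dom) →
      (∀ y ∈ F, y ∉ f.im → y ∉ g.im) → g ∈ U := by
  induction hU with
  | basic s hs =>
    intro f hf
    rcases hs with (⟨x, y, rfl⟩ | ⟨x, rfl⟩) | ⟨y, rfl⟩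
    · exact ⟨{x}, Set.finite_singleton x, fun g h1 _ _ => h1 x rfl y hf⟩
    · exact ⟨{x}, Set.finite_singleton x, fun g _ h2 _ => h2 x rfl hf⟩
    · exact ⟨{y}, Set.finite_singleton y, fun g _ _ h3 => h3 y rfl hf⟩
  | univ => exact fun f _ => ⟨∅, Set.finite_empty, fun g _ _ _ => trivial⟩
  | inter s t _ _ ihs iht =>
    intro f hf
    obtain ⟨F, hF, h⟩ := ihs f hf.1
    obtain ⟨G, hG, h'⟩ := iht f hf.2
    refine ⟨F ∪ G, hF.union hG, fun g h1 h2 h3 => ⟨h g ?_ ?_ ?_, h' g ?_ ?_ ?_⟩⟩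
    · exact fun x hx => h1 x (Or.inl hx)
    · exact fun x hx => h2 x (Or.inl hx)
    · exact fun x hx => h3 x (Or.inl hx)
    · exact fun x hx => h1 x (Or.inr hx)
    · exact fun x hx => h2 x (Or.inr hx)
    · exact fun x hx => h3 x (Or.inr hx)
  | sUnion S _ ih =>
    rintro f ⟨s, hs, hf⟩
    obtain ⟨F, hF, h⟩ := ih s hs f hf
    exact ⟨F, hF, fun g h1 h2 h3 => ⟨s, hs, h g h1 h2 h3⟩⟩

theorem isOpen_cyl {X : Type*} (B : Set X) (F : Set X) (hF : F.Finite) :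
    IsOpen[cantorTop X] {A : Set X | ∀ x ∈ F, (x ∈ A ↔ x ∈ B)} := by
  letI := cantorTop X
  have : {A : Set X | ∀ x ∈ F, (x ∈ A ↔ x ∈ B)} = ⋂ x ∈ F, {A : Set X | x ∈ A ↔ x ∈ B} := by
    ext A; simp
  rw [this]
  refine hF.isOpen_biInter fun x _ => ?_
  by_cases hx : x ∈ B
  · simp only [hx, iff_true]
    exact GenerateOpen.basic _ (Or.inl ⟨x, rfl⟩)
  · simp only [hx, iff_false]
    exact GenerateOpen.basic _ (Or.inr ⟨x, rfl⟩)

theorem exists_inj {X : Type*} [Infinite X] (S : Set X) (hS : S.Finite) :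
    ∃ e : X → X, Function.Injective e ∧ ∀ x, e x ∉ S := by
  have h : Cardinal.mk (Sᶜ : Set X) = Cardinal.mk X :=
    Cardinal.mk_compl_of_infinite S
      (lt_of_lt_of_le hS.lt_aleph0 (Cardinal.aleph0_le_mk X))
  obtain ⟨e⟩ := Cardinal.eq.1 h
  exact ⟨fun x => (e.symm x : X), Subtype.val_injective.comp e.symm.injective,
    fun x => (e.symm x).2⟩

theorem exists_ext {X : Type*} [Infinite X] (f : PartialBij X) (F : Set X) (hF : F.Finite)
    (A : Set X) (hA : ∀ x ∈ F, (x ∈ A ↔ x ∈ f.dom)) :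
    ∃ g : PartialBij X, g.dom = A ∧
      (∀ x ∈ F, ∀ y, (x, y) ∈ f.graph → (x, y) ∈ g.graph) ∧
      (∀ y ∈ F, y ∉ f.im → y ∉ g.im) := by
  have hfin : {y | ∃ x ∈ F, (x, y) ∈ f.graph}.Finite := by
    have : {y | ∃ x ∈ F, (x, y) ∈ f.graph} = ⋃ x ∈ F, {y | (x, y) ∈ f.graph} := by
      ext y; simp
    rw [this]
    exact hF.biUnion fun x _ => Set.Subsingleton.finite fun y hy y' hy' => f.functional hy hy'
  obtain ⟨e, he, heS⟩ := exists_inj _ (hF.union hfin)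
  refine ⟨⟨{p | p.1 ∈ A ∧ ((p.1 ∈ F ∧ p ∈ f.graph) ∨ (p.1 ∉ F ∧ p.2 = e p.1))}, ?_, ?_⟩,
    ?_, ?_, ?_⟩
  · rintro x y y' ⟨_, ⟨h, h1⟩ | ⟨h, h1⟩⟩ ⟨_, ⟨h', h1'⟩ | ⟨h', h1'⟩⟩
    · exact f.functional h1 h1'
    · exact absurd h h'
    · exact absurd h' h
    · exact h1.trans h1'.symm
  · rintro x x' y ⟨_, ⟨h, h1⟩ | ⟨h, h1⟩⟩ ⟨_, ⟨h', h1'⟩ | ⟨h', h1'⟩⟩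
    · exact f.coinjective h1 h1'
    · exact absurd (Or.inr ⟨x, h, h1' ▸ h1⟩) (heS x')
    · exact absurd (Or.inr ⟨x', h', h1 ▸ h1'⟩) (heS x)
    · exact he (h1.symm.trans h1')
  · ext x
    constructor
    · rintro ⟨y, h, _⟩
      exact h
    · intro hx
      by_cases hxF : x ∈ F
      · obtain ⟨y, hy⟩ := (hA x hxF).1 hx
        exact ⟨y, hx, Or.inl ⟨hxF, hy⟩⟩
      · exact ⟨e x, hx, Or.inr ⟨hxF, rfl⟩⟩
  · exact fun x hx y hy => ⟨(hA x hx).2 ⟨y, hy⟩, Or.inl ⟨hx, hy⟩⟩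
  · rintro y hy hyf ⟨x, _, ⟨_, h⟩ | ⟨_, h⟩⟩
    · exact hyf ⟨x, h⟩
    · have h' : y = e x := h
      exact heS x (Or.inl (h' ▸ hy))

theorem isOpenMap_dom (X : Type*) :
    @IsOpenMap (PartialBij X) (Set X) (taupp X) (cantorTop X) dom := by
  letI := cantorTop X
  intro U hU
  rw [isOpen_iff_forall_mem_open]
  rintro _ ⟨f, hf, rfl⟩
  cases finite_or_infinite X with
  | inl hX =>
    refine ⟨_, ?_, isOpen_cyl f.dom Set.univ Set.finite_univ, fun _ _ => Iff.rfl⟩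
    intro A hA
    exact ⟨f, hf, Set.ext fun x => (hA x trivial).symm⟩
  | inr hX =>
    obtain ⟨F, hF, h⟩ := exists_finite_nhd U hU f hf
    refine ⟨_, ?_, isOpen_cyl f.dom F hF, fun _ _ => Iff.rfl⟩
    intro A hA
    obtain ⟨g, hg, h1, h3⟩ := exists_ext f F hF A hA
    refine ⟨g, h g h1 (fun x hx hxf => ?_) h3, hg⟩
    rw [hg]
    exact fun hxA => hxf ((hA x hx).1 hxA)

theorem continuous_inv' (X : Type*) :
    @Continuous (PartialBij X) (PartialBij X) (taupp X) (taupp X) inv := by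
  letI := taupp X
  refine continuous_generateFrom_iff.2 ?_
  rintro s ((⟨x, y, rfl⟩ | ⟨x, rfl⟩) | ⟨y, rfl⟩)
  · exact GenerateOpen.basic _ (Or.inl (Or.inl ⟨y, x, rfl⟩))
  · exact GenerateOpen.basic _ (Or.inr ⟨x, rfl⟩)
  · exact GenerateOpen.basic _ (Or.inl (Or.inr ⟨y, rfl⟩))

end PartialBij

open PartialBij in
/-- `dom` and `im` are open maps from `(I(X), τ_pp)` to `2^X` with the product
topology. -/
theorem dom_im_open_maps (X : Type*) :
    @IsOpenMap (PartialBij X) (Set X) (taupp X) (cantorTop X) dom ∧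
    @IsOpenMap (PartialBij X) (Set X) (taupp X) (cantorTop X) im := by
  refine ⟨isOpenMap_dom X, ?_⟩
  intro U hU
  have h1 : IsOpen[taupp X] (inv ⁻¹' U) :=
    (@continuous_def _ _ (taupp X) (taupp X) _).1 (continuous_inv' X) U hU
  have h2 : im '' U = dom '' (inv ⁻¹' U) := by
    ext A
    constructor
    · rintro ⟨f, hf, rfl⟩
      exact ⟨inv f, hf, rfl⟩
    · rintro ⟨f, hf, rfl⟩
      exact ⟨inv f, hf, rfl⟩
  rw [h2]
  exact isOpenMap_dom X _ h1
end

section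
/- The set of idempotents of I(X), namely {1_A : A ⊆ X}, is compact in (I(X), τ_pp). -/
open TopologicalSpace Filter

open PartialBij in
/-- The set of idempotents `{1_A : A ⊆ X}` of `I(X)` is `τ_pp`-compact. -/
theorem idempotents_compact (X : Type*) :
    @IsCompact (PartialBij X) (taupp X)
      (Set.range (partialId : Set X → PartialBij X)) := by
  letI := taupp X
  have hc : Continuous (fun f : X → Bool => (partialId {x | f x = true} : PartialBij X)) := by
    have h0 : ∀ x : X, Continuous (fun f : X → Bool => f x) := fun x => by fun_prop
    have h1 : ∀ x : X, IsOpen {f : X → Bool | f x = true} := fun x =>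
      (isOpen_discrete ({true} : Set Bool)).preimage (h0 x)
    have h2 : ∀ x : X, IsOpen {f : X → Bool | f x = false} := fun x =>
      (isOpen_discrete ({false} : Set Bool)).preimage (h0 x)
    refine continuous_generateFrom_iff.2 ?_
    rintro s ((⟨x, y, rfl⟩ | ⟨x, rfl⟩) | ⟨y, rfl⟩)
    · by_cases hxy : x = y
      · convert h1 x using 1
        ext f
        simp [v, partialId, hxy]
      · convert isOpen_empty using 1
        ext f
        simp [v, partialId, hxy]
    · convert h2 x using 1
      ext f
      simp [w1, dom, partialId]
    · convert h2 y using 1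
      ext f
      simp only [w2, im, partialId, Set.mem_preimage, Set.mem_setOf_eq, not_exists, not_and]
      constructor
      · intro h
        by_contra hf
        exact h y (by simpa using hf) rfl
      · rintro h x hx rfl
        simp [h] at hx
  have hr : Set.range (partialId : Set X → PartialBij X)
      = Set.range (fun f : X → Bool => (partialId {x | f x = true} : PartialBij X)) := by
    classical
    ext g
    constructor
    · rintro ⟨A, rfl⟩
      exact ⟨fun x => decide (x ∈ A), by simp⟩
    · rintro ⟨f, rfl⟩
      exact ⟨_, rfl⟩
  rw [hr]
  exact isCompact_range hc
end

section
/- The metric ρ on I(ℕ) is a complete metric whose induced topology is τ₁; in particular (I(ℕ), τ₁) is a Polish topological semigroup. -/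
open TopologicalSpace Filter

namespace PartialBij

open Classical in
/-- `a_{(f,g)}(n)`: 0 if `n` belongs to both or neither of the domains, 1 otherwise. -/
noncomputable def aFn (f g : PartialBij ℕ) (n : ℕ) : ℝ :=
  if n ∈ f.dom ↔ n ∈ g.dom then 0 else 1

open Classical in
/-- `b_{(f,g)}(n)`: `min {1, |f(n) - g(n)|}` if `n` is in both domains, `0` otherwise. -/
noncomputable def bFn (f g : PartialBij ℕ) (n : ℕ) : ℝ :=
  if n ∈ f.dom ∧ n ∈ g.dom then min 1 (Nat.dist (evalAt n f) (evalAt n g)) else 0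

/-- The metric `ρ(f,g) = Σ_n (a_{(f,g)}(n) + b_{(f,g)}(n)) / 2ⁿ` on `I(ℕ)`. -/
noncomputable def rho (f g : PartialBij ℕ) : ℝ :=
  ∑' n : ℕ, (aFn f g n + bFn f g n) / 2 ^ n

end PartialBij

namespace PartialBij

open Classical in
/-- The value of `f` at `n` as an option. -/
noncomputable def ev (f : PartialBij ℕ) (n : ℕ) : Option ℕ :=
  if n ∈ f.dom then some (evalAt n f) else none

lemma evalAt_mem_s15 {f : PartialBij ℕ} {n : ℕ} (h : n ∈ f.dom) : (n, evalAt n f) ∈ f.graph := by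
  unfold evalAt
  rw [dif_pos h]
  exact h.choose_spec

lemma ev_eq_some {f : PartialBij ℕ} {n y : ℕ} : ev f n = some y ↔ (n, y) ∈ f.graph := by
  unfold ev
  split_ifs with h
  · constructor
    · intro e
      rw [← Option.some.inj e]
      exact evalAt_mem_s15 h
    · intro e
      rw [f.functional e (evalAt_mem_s15 h)]
  · simp only [false_iff]
    exact fun e => h ⟨y, e⟩

lemma ev_eq_none {f : PartialBij ℕ} {n : ℕ} : ev f n = none ↔ n ∉ f.dom := by
  unfold ev
  split_ifs with h <;> simp [h]

lemma ext_ev {f g : PartialBij ℕ} (h : ∀ n, ev f n = ev g n) : f = g := by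
  have : f.graph = g.graph := by
    ext ⟨x, y⟩
    rw [← ev_eq_some, ← ev_eq_some, h]
  cases f; cases g; simp_all

/-- The summand numerator. -/
noncomputable def tm (f g : PartialBij ℕ) (n : ℕ) : ℝ := if ev f n = ev g n then 0 else 1

lemma ab_eq (f g : PartialBij ℕ) (n : ℕ) : aFn f g n + bFn f g n = tm f g n := by
  unfold aFn bFn tm ev
  by_cases hf : n ∈ f.dom <;> by_cases hg : n ∈ g.dom <;> simp [hf, hg]
  split_ifs with h
  · simp [h]
  · rw [min_eq_left]
    have : 0 < Nat.dist (evalAt n f) (evalAt n g) := Nat.dist_pos_of_ne h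
    exact_mod_cast this

lemma tm_nonneg (f g : PartialBij ℕ) (n : ℕ) : 0 ≤ tm f g n := by
  unfold tm; split_ifs <;> norm_num

lemma tm_le (f g : PartialBij ℕ) (n : ℕ) : tm f g n ≤ 1 := by
  unfold tm; split_ifs <;> norm_num

lemma tm_comm (f g : PartialBij ℕ) (n : ℕ) : tm f g n = tm g f n := by
  unfold tm; simp only [eq_comm]

lemma tm_tri (f g h : PartialBij ℕ) (n : ℕ) : tm f h n ≤ tm f g n + tm g h n := by
  unfold tm; 
  by_cases h2 : ev f n = ev g n
  · rw [h2]; simp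
  · rw [if_neg h2]
    split_ifs <;> norm_num

lemma rho_eq (f g : PartialBij ℕ) : rho f g = ∑' n, tm f g n / 2 ^ n := by
  unfold rho; simp only [ab_eq]

lemma summ_geo : Summable (fun n : ℕ => (1 : ℝ) / 2 ^ n) := by
  simpa using summable_geometric_two

lemma summ (f g : PartialBij ℕ) : Summable (fun n => tm f g n / 2 ^ n) := by
  refine Summable.of_nonneg_of_le (fun n => div_nonneg (tm_nonneg f g n) (by positivity))
    (fun n => ?_) summ_geo
  have := tm_le f g n
  gcongr

lemma ev_of_rho_lt {f g : PartialBij ℕ} {n : ℕ} (h : rho f g < 1 / 2 ^ n) : ev f n = ev g n := by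
  by_contra hne
  have h1 := (summ f g).le_tsum n (fun j _ => div_nonneg (tm_nonneg f g j) (by positivity))
  rw [← rho_eq] at h1
  simp only [tm, if_neg hne] at h1
  linarith

lemma rho_le_of_ev {f g : PartialBij ℕ} {n : ℕ} (h : ∀ k < n, ev f k = ev g k) :
    rho f g ≤ 2 / 2 ^ n := by
  rw [rho_eq, ← (summ f g).sum_add_tsum_nat_add n]
  have h0 : ∑ k ∈ Finset.range n, tm f g k / 2 ^ k = 0 := by
    refine Finset.sum_eq_zero fun k hk => ?_
    simp [tm, h k (Finset.mem_range.1 hk)]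
  rw [h0, zero_add]
  have h2 : HasSum (fun k : ℕ => (1 / 2 ^ n : ℝ) * (1 / 2) ^ k) ((1 / 2 ^ n) * 2) :=
    hasSum_geometric_two.mul_left _
  have h3 : (2 : ℝ) / 2 ^ n = ∑' k : ℕ, (1 / 2 ^ n : ℝ) * (1 / 2) ^ k := by
    rw [h2.tsum_eq]; ring
  rw [h3]
  refine Summable.tsum_le_tsum (fun k => ?_) ((summable_nat_add_iff n).2 (summ f g)) h2.summable
  have := tm_le f g (k + n)
  calc tm f g (k + n) / 2 ^ (k + n) ≤ 1 / 2 ^ (k + n) := by gcongr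
    _ = _ := by rw [pow_add, one_div_pow]; field_simp

/-- The metric. -/
noncomputable abbrev rhoMetric : MetricSpace (PartialBij ℕ) where
  dist := rho
  dist_self f := by simp [rho_eq, tm]
  dist_comm f g := by simp only [rho_eq, tm_comm f g]
  dist_triangle f g h := by
    rw [rho_eq, rho_eq, rho_eq, ← (summ f g).tsum_add (summ g h)]
    refine Summable.tsum_le_tsum (fun k => ?_) (summ f h) ((summ f g).add (summ g h))
    rw [← add_div]
    have := tm_tri f g h k
    gcongr
  eq_of_dist_eq_zero {f g} h := by
    refine ext_ev fun n => ev_of_rho_lt ?_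
    have h' : rho f g = 0 := h
    rw [h']; positivity

lemma isOpen_v_s15 (x y : ℕ) : @IsOpen _ (tau1 ℕ) (v x y) :=
  isOpen_generateFrom_of_mem (Or.inl ⟨x, y, rfl⟩)

lemma isOpen_w1 (x : ℕ) : @IsOpen _ (tau1 ℕ) (w1 x) :=
  isOpen_generateFrom_of_mem (Or.inr ⟨x, rfl⟩)

lemma ev_none_set (x : ℕ) : {g : PartialBij ℕ | ev g x = none} = w1 x := by
  ext g; exact ev_eq_none

lemma ev_some_set (x y : ℕ) : {g : PartialBij ℕ | ev g x = some y} = v x y := by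
  ext g; exact ev_eq_some

lemma isOpen_ev (k : ℕ) (o : Option ℕ) : @IsOpen _ (tau1 ℕ) {g | ev g k = o} := by
  cases o with
  | none => rw [ev_none_set]; exact isOpen_w1 k
  | some y => rw [ev_some_set]; exact isOpen_v_s15 k y

lemma exists_pow {ε : ℝ} (h : 0 < ε) : ∃ n : ℕ, (2 : ℝ) / 2 ^ n < ε := by
  obtain ⟨n, hn⟩ := exists_pow_lt_of_lt_one (half_pos h) (by norm_num : (1 / 2 : ℝ) < 1)
  refine ⟨n, ?_⟩
  rw [one_div_pow] at hn
  have : (2 : ℝ) / 2 ^ n = 2 * (1 / 2 ^ n) := by ring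
  linarith

lemma rho_top : rhoMetric.toUniformSpace.toTopologicalSpace = tau1 ℕ := by
  letI := rhoMetric
  have hev : ∀ (k : ℕ) (o : Option ℕ), IsOpen {g : PartialBij ℕ | ev g k = o} := by
    intro k o
    rw [Metric.isOpen_iff]
    intro f hf
    refine ⟨1 / 2 ^ k, by positivity, fun g hg => ?_⟩
    exact (ev_of_rho_lt (Metric.mem_ball.1 hg)).trans hf
  apply le_antisymm
  · refine le_generateFrom ?_
    rintro s (⟨x, y, rfl⟩ | ⟨x, rfl⟩)
    · have := hev x (some y)
      rwa [ev_some_set] at this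
    · have := hev x none
      rwa [ev_none_set] at this
  · intro s hs
    have hs' := Metric.isOpen_iff.1 hs
    refine (@isOpen_iff_forall_mem_open _ (tau1 ℕ) s).2 ?_
    intro f hf
    obtain ⟨ε, hε, hb⟩ := hs' f hf
    obtain ⟨n, hn⟩ := exists_pow hε
    refine ⟨⋂ k ∈ Finset.range n, {g | ev g k = ev f k}, ?_, ?_, ?_⟩
    · intro g hg
      simp only [Finset.mem_range, Set.mem_iInter, Set.mem_ofPred_eq] at hg
      exact hb (Metric.mem_ball.2 ((rho_le_of_ev hg).trans_lt hn))
    · exact @isOpen_biInter_finset _ _ (tau1 ℕ) _ _ fun k _ => isOpen_ev k _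
    · simp

lemma rho_complete : @CompleteSpace (PartialBij ℕ) rhoMetric.toUniformSpace := by
  letI := rhoMetric
  refine Metric.complete_of_cauchySeq_tendsto fun u hu => ?_
  have h1 : ∀ k, ∃ N, ∀ n ≥ N, ev (u n) k = ev (u N) k := by
    intro k
    obtain ⟨N, hN⟩ := Metric.cauchySeq_iff'.1 hu (1 / 2 ^ k) (by positivity)
    exact ⟨N, fun n hn => ev_of_rho_lt (hN n hn)⟩
  choose N hN using h1
  let L : PartialBij ℕ :=
    { graph := {p | ev (u (N p.1)) p.1 = some p.2}
      functional := by
        intro x y y' h h'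
        exact Option.some.inj (h.symm.trans h')
      coinjective := by
        intro x x' y h h'
        have e1 := (hN x (max (N x) (N x')) (le_max_left _ _)).trans h
        have e2 := (hN x' (max (N x) (N x')) (le_max_right _ _)).trans h'
        exact (u _).coinjective (ev_eq_some.1 e1) (ev_eq_some.1 e2) }
  have hL : ∀ k, ev L k = ev (u (N k)) k := by
    intro k
    ext y
    exact ev_eq_some
  refine ⟨L, Metric.tendsto_atTop.2 fun ε hε => ?_⟩
  obtain ⟨n, hn⟩ := exists_pow hε
  refine ⟨(Finset.range n).sup N, fun m hm => ?_⟩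
  refine lt_of_le_of_lt (rho_le_of_ev fun k hk => ?_) hn
  rw [hL]
  exact hN k m ((Finset.le_sup (f := N) (Finset.mem_range.2 hk)).trans hm)

lemma tau1_sc : @SecondCountableTopology (PartialBij ℕ) (tau1 ℕ) := by
  refine @SecondCountableTopology.mk _ (tau1 ℕ) ⟨_, ?_, rfl⟩
  refine Set.Countable.union ?_ ?_
  · refine (Set.countable_range fun p : ℕ × ℕ => (v p.1 p.2 : Set (PartialBij ℕ))).mono ?_
    rintro s ⟨x, y, rfl⟩
    exact ⟨(x, y), rfl⟩
  · refine (Set.countable_range fun p : ℕ => (w1 p : Set (PartialBij ℕ))).mono ?_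
    rintro s ⟨x, rfl⟩
    exact ⟨x, rfl⟩

lemma tau1_polish : @PolishSpace (PartialBij ℕ) (tau1 ℕ) := by
  have h := tau1_sc
  have hc := rho_complete
  rw [← rho_top] at h ⊢
  letI := rhoMetric
  infer_instance

lemma comp_cont : @Continuous (PartialBij ℕ × PartialBij ℕ) (PartialBij ℕ)
      (@instTopologicalSpaceProd _ _ (tau1 ℕ) (tau1 ℕ)) (tau1 ℕ)
      (fun p => p.1.comp p.2) := by
  letI := tau1 ℕ
  refine continuous_generateFrom_iff.2 ?_
  rintro s (⟨x, y, rfl⟩ | ⟨x, rfl⟩)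
  · have : (fun p : PartialBij ℕ × PartialBij ℕ => p.1.comp p.2) ⁻¹' v x y
        = ⋃ z, (v z y) ×ˢ (v x z) := by
      ext ⟨f, g⟩
      simp [v, comp, and_comm]
    rw [this]
    exact isOpen_iUnion fun z => (isOpen_v_s15 z y).prod (isOpen_v_s15 x z)
  · have : (fun p : PartialBij ℕ × PartialBij ℕ => p.1.comp p.2) ⁻¹' w1 x
        = (Set.univ ×ˢ w1 x) ∪ ⋃ z, (w1 z) ×ˢ (v x z) := by
      ext ⟨f, g⟩
      simp only [w1, v, comp, dom, Set.mem_preimage, Set.mem_ofPred_eq, Set.mem_union,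
        Set.mem_prod, Set.mem_univ, true_and, Set.mem_iUnion]
      constructor
      · intro h
        by_cases hx : ∃ z, (x, z) ∈ g.graph
        · obtain ⟨z, hz⟩ := hx
          exact Or.inr ⟨z, fun ⟨y, hy⟩ => h ⟨y, z, hz, hy⟩, hz⟩
        · exact Or.inl hx
      · rintro (h | ⟨z, h, hz⟩) ⟨y, z', h1, h2⟩
        · exact h ⟨z', h1⟩
        · obtain rfl := g.functional hz h1
          exact h ⟨y, h2⟩
    rw [this]
    exact (isOpen_univ.prod (isOpen_w1 x)).union
      (isOpen_iUnion fun z => (isOpen_w1 z).prod (isOpen_v_s15 x z))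

end PartialBij

open PartialBij in
/-- `ρ` is a complete metric on `I(ℕ)` inducing `τ₁`; in particular
`(I(ℕ), τ₁)` is a Polish topological semigroup. -/
theorem rho_complete_metric_for_tau1 :
    (∃ m : MetricSpace (PartialBij ℕ),
      (∀ f g : PartialBij ℕ, @dist (PartialBij ℕ) m.toDist f g = rho f g) ∧
      m.toUniformSpace.toTopologicalSpace = tau1 ℕ ∧
      @CompleteSpace (PartialBij ℕ) m.toUniformSpace) ∧
    @PolishSpace (PartialBij ℕ) (tau1 ℕ) ∧
    @Continuous (PartialBij ℕ × PartialBij ℕ) (PartialBij ℕ)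
      (@instTopologicalSpaceProd _ _ (tau1 ℕ) (tau1 ℕ)) (tau1 ℕ)
      (fun p => p.1.comp p.2) := by
  exact ⟨⟨rhoMetric, fun _ _ => rfl, rho_top, rho_complete⟩, tau1_polish, comp_cont⟩
end

section
/- Let X be an infinite set and X ⊆ Y with |X| ≤ |Y \ X|. Then the map π : S_∞(Y) → (I(X), τ_pp), π(f) = f̂, is continuous, surjective and open, where S_∞(Y) carries the topology inherited from the product topology on Y^Y (Y discrete). -/
open TopologicalSpace Filter

/-- The topology of the symmetric group `S_∞(Y)`, inherited from the product
topology on `Y^Y` with `Y` discrete. -/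
def permTop (Y : Type*) : TopologicalSpace (Equiv.Perm Y) :=
  TopologicalSpace.induced (fun f => (f : Y → Y))
    (@Pi.topologicalSpace Y (fun _ => Y) (fun _ => ⊥))

/-- The restriction map `π : S_∞(Y) → I(X)`, `π(f) = f̂ = {(x, f(x)) : x ∈ X, f(x) ∈ X}`. -/
def restrictPerm {Y : Type*} (X : Set Y) (f : Equiv.Perm Y) : PartialBij X where
  graph := {p | f p.1 = (p.2 : Y)}
  functional := fun _ _ _ h h' => Subtype.ext (h.symm.trans h')
  coinjective := fun _ _ _ h h' => Subtype.ext (f.injective (h.trans h'.symm))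

universe u

theorem aux_ext {X : Type*} (f g : PartialBij X) (h : f.graph = g.graph) : f = g := by
  cases f
  cases g
  cases h
  rfl

theorem aux_card {Y : Type*} (X S : Set Y) (hX : (Xᶜ).Infinite) (hf : (S ∩ Xᶜ).Finite) :
    Cardinal.mk {a : ↥(Sᶜ) // ¬ ((a : Y) ∈ X)} = Cardinal.mk ↥(Xᶜ) := by
  have e : {a : ↥(Sᶜ) // ¬ ((a : Y) ∈ X)} ≃ ↥(Xᶜ \ (S ∩ Xᶜ)) :=
    { toFun := fun a => ⟨a.1.1, a.2, fun h => a.1.2 h.1⟩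
      invFun := fun b => ⟨⟨b.1, fun h => b.2.2 ⟨h, b.2.1⟩⟩, b.2.1⟩
      left_inv := fun a => rfl
      right_inv := fun b => rfl }
  rw [Cardinal.mk_congr e]
  have hinf : Cardinal.aleph0 ≤ Cardinal.mk ↥(Xᶜ) := Cardinal.infinite_iff.1 hX.to_subtype
  have h1 := Cardinal.mk_sdiff_add_mk (S := Xᶜ) (T := S ∩ Xᶜ) Set.inter_subset_right
  have h2 : Cardinal.mk ↥(S ∩ Xᶜ) < Cardinal.aleph0 := Cardinal.lt_aleph0_iff_set_finite.2 hf
  have h3 : Cardinal.aleph0 ≤ Cardinal.mk ↥(Xᶜ \ (S ∩ Xᶜ)) := by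
    by_contra h
    have := Cardinal.add_lt_aleph0 (not_le.1 h) h2
    rw [h1] at this
    exact absurd hinf (not_le.2 this)
  rw [← h1, Cardinal.add_eq_left h3 (h2.le.trans h3)]

theorem aux_equiv {α β : Type u} (p : α → Prop) (q : β → Prop) (k : Cardinal.{u})
    (hk : Cardinal.aleph0 ≤ k)
    (hp : Cardinal.mk {a // p a} ≤ k) (hq : Cardinal.mk {b // q b} ≤ k)
    (hp' : Cardinal.mk {a // ¬ p a} = k) (hq' : Cardinal.mk {b // ¬ q b} = k) :
    ∃ e : α ≃ β, ∀ a, p a → ¬ q (e a) := by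
  classical
  have h1 : Nonempty ({a // ¬ p a} ≃ {b // q b} ⊕ {b // ¬ q b}) := by
    rw [← Cardinal.eq, Cardinal.mk_sum, Cardinal.lift_id, Cardinal.lift_id, hp', hq',
      Cardinal.add_eq_right hk hq]
  have h2 : Nonempty ({a // p a} ⊕ {b // ¬ q b} ≃ {b // ¬ q b}) := by
    rw [← Cardinal.eq, Cardinal.mk_sum, Cardinal.lift_id, Cardinal.lift_id, hq',
      Cardinal.add_eq_right hk hp]
  obtain ⟨e1⟩ := h1
  obtain ⟨e2⟩ := h2
  let e3 : {a // p a} ⊕ ({b // q b} ⊕ {b // ¬ q b}) ≃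
      {b // q b} ⊕ ({a // p a} ⊕ {b // ¬ q b}) :=
    ((Equiv.sumAssoc _ _ _).symm.trans
      (Equiv.sumCongr (Equiv.sumComm _ _) (Equiv.refl _))).trans (Equiv.sumAssoc _ _ _)
  refine ⟨(Equiv.sumCompl p).symm.trans ((Equiv.sumCongr (Equiv.refl _) e1).trans
    (e3.trans ((Equiv.sumCongr (Equiv.refl _) e2).trans (Equiv.sumCompl q)))), ?_⟩
  intro a ha
  have : (Equiv.sumCompl p).symm a = Sum.inl ⟨a, ha⟩ := by
    rw [Equiv.symm_apply_eq]; rfl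
  simp only [Equiv.trans_apply, this]
  exact (e2 (Sum.inl ⟨a, ha⟩)).2

theorem aux_extend {Y : Type*} (X : Set Y)
    (hinf : X.Infinite) (hcard : Cardinal.mk X ≤ Cardinal.mk ↥(Xᶜ))
    (h : PartialBij X) (f : Equiv.Perm Y) (F : Set Y) (hF : F.Finite)
    (h1 : ∀ x y : X, (x : Y) ∈ F → f x = y → (x, y) ∈ h.graph)
    (h2 : ∀ x : X, (x : Y) ∈ F → f x ∉ X → x ∉ h.dom)
    (h3 : ∀ z : Y, ∀ y : X, z ∈ F → z ∉ X → f z = y → y ∉ h.im) :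
    ∃ g : Equiv.Perm Y, (∀ z ∈ F, g z = f z) ∧ restrictPerm X g = h := by
  classical
  have hk : Cardinal.aleph0 ≤ Cardinal.mk ↥(Xᶜ) :=
    (Cardinal.infinite_iff.1 hinf.to_subtype).trans hcard
  have hXc : (Xᶜ).Infinite := Set.infinite_coe_iff.1 (Cardinal.infinite_iff.2 hk)
  let R : Y → Y → Prop := fun a b =>
    (∃ (ha : a ∈ X) (hb : b ∈ X), ((⟨a, ha⟩ : X), (⟨b, hb⟩ : X)) ∈ h.graph) ∨ (a ∈ F ∧ f a = b)
  have mix1 : ∀ a b b' (ha : a ∈ X) (hb : b ∈ X),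
      ((⟨a, ha⟩ : X), (⟨b, hb⟩ : X)) ∈ h.graph → a ∈ F → f a = b' → b = b' := by
    intro a b b' ha hb hab haF hfa
    by_cases hb' : b' ∈ X
    · exact congrArg Subtype.val (h.functional hab (h1 ⟨a, ha⟩ ⟨b', hb'⟩ haF hfa))
    · exact absurd ⟨_, hab⟩ (h2 ⟨a, ha⟩ haF (by rwa [hfa]))
  have mix2 : ∀ a a' b (ha : a ∈ X) (hb : b ∈ X),
      ((⟨a, ha⟩ : X), (⟨b, hb⟩ : X)) ∈ h.graph → a' ∈ F → f a' = b → a = a' := by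
    intro a a' b ha hb hab haF hfa
    by_cases ha' : a' ∈ X
    · exact congrArg Subtype.val (h.coinjective hab (h1 ⟨a', ha'⟩ ⟨b, hb⟩ haF hfa))
    · exact absurd ⟨_, hab⟩ (h3 a' ⟨b, hb⟩ haF ha' hfa)
  have Rf : ∀ a b b', R a b → R a b' → b = b' := by
    rintro a b b' (⟨ha, hb, hab⟩ | ⟨haF, hab⟩) (⟨ha', hb', hab'⟩ | ⟨haF', hab'⟩)
    · exact congrArg Subtype.val (h.functional hab hab')
    · exact mix1 a b b' ha hb hab haF' hab'
    · exact (mix1 a b' b ha' hb' hab' haF hab).symm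
    · exact hab.symm.trans hab'
  have Ri : ∀ a a' b, R a b → R a' b → a = a' := by
    rintro a a' b (⟨ha, hb, hab⟩ | ⟨haF, hab⟩) (⟨ha', hb', hab'⟩ | ⟨haF', hab'⟩)
    · exact congrArg Subtype.val (h.coinjective hab hab')
    · exact mix2 a a' b ha hb hab haF' hab'
    · exact (mix2 a' a b ha' hb' hab' haF hab).symm
    · exact f.injective (hab.trans hab'.symm)
  let S : Set Y := {a | ∃ b, R a b}
  let T : Set Y := {b | ∃ a, R a b}
  have hS : (S ∩ Xᶜ).Finite := by
    refine hF.subset ?_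
    rintro a ⟨⟨b, ⟨ha, _⟩ | ⟨haF, _⟩⟩, haX⟩
    · exact absurd ha haX
    · exact haF
  have hT : (T ∩ Xᶜ).Finite := by
    refine (hF.image f).subset ?_
    rintro b ⟨⟨a, ⟨_, hb, _⟩ | ⟨haF, hab⟩⟩, hbX⟩
    · exact absurd hb hbX
    · exact ⟨a, haF, hab⟩
  have small : ∀ U : Set Y, Cardinal.mk {a : ↥(Uᶜ) // (a : Y) ∈ X} ≤ Cardinal.mk ↥(Xᶜ) := by
    intro U
    refine le_trans ?_ hcard
    exact Cardinal.mk_le_of_injective (f := fun a => (⟨a.1.1, a.2⟩ : X))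
      (fun a b hab => Subtype.ext (Subtype.ext (Subtype.mk.inj hab)))
  obtain ⟨e, he⟩ := aux_equiv (α := ↥(Sᶜ)) (β := ↥(Tᶜ)) (fun a => (a : Y) ∈ X)
    (fun b => (b : Y) ∈ X) _ hk (small S) (small T) (aux_card X S hXc hS) (aux_card X T hXc hT)
  choose φ hφ using fun a : S => a.2
  choose ψ hψ using fun b : T => b.2
  let e1 : S ≃ T :=
    { toFun := fun a => ⟨φ a, a, hφ a⟩
      invFun := fun b => ⟨ψ b, b, hψ b⟩
      left_inv := fun a => Subtype.ext (Ri _ _ _ (hψ _) (hφ a))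
      right_inv := fun b => Subtype.ext (Rf _ _ _ (hφ _) (hψ b)) }
  let g : Equiv.Perm Y := (Equiv.Set.sumCompl S).symm.trans
    ((Equiv.sumCongr e1 e).trans (Equiv.Set.sumCompl T))
  have gR : ∀ a b, R a b → g a = b := by
    intro a b hab
    have ha : a ∈ S := ⟨b, hab⟩
    have : g a = φ ⟨a, ha⟩ := by
      simp only [g, Equiv.trans_apply, Equiv.Set.sumCompl_symm_apply_of_mem ha]
      rfl
    rw [this]
    exact Rf _ _ _ (hφ ⟨a, ha⟩) hab
  have gN : ∀ a (ha : a ∉ S), g a = e ⟨a, ha⟩ := by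
    intro a ha
    simp only [g, Equiv.trans_apply, Equiv.Set.sumCompl_symm_apply_of_notMem ha]
    rfl
  refine ⟨g, fun z hz => gR _ _ (Or.inr ⟨hz, rfl⟩), ?_⟩
  have hgr : (restrictPerm X g).graph = h.graph := by
    ext ⟨x, y⟩
    constructor
    · intro hxy
      have hxy : g x = y := hxy
      by_cases hx : (x : Y) ∈ S
      · obtain ⟨b, hb⟩ := hx
        have hby : b = y := (gR _ _ hb).symm.trans hxy
        subst hby
        rcases hb with ⟨_, _, hb⟩ | ⟨hxF, hb⟩
        · exact hb
        · exact h1 x y hxF hb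
      · exfalso
        rw [gN _ hx] at hxy
        exact he ⟨x, hx⟩ x.2 (by rw [hxy]; exact y.2)
    · intro hxy
      exact gR x y (Or.inl ⟨x.2, y.2, hxy⟩)
  exact aux_ext _ _ hgr

theorem aux_eval_open {Y : Type*} (z : Y) (U : Set Y) :
    @IsOpen _ (permTop Y) {f : Equiv.Perm Y | f z ∈ U} := by
  letI : TopologicalSpace Y := ⊥
  haveI : DiscreteTopology Y := ⟨rfl⟩
  refine ⟨{φ : Y → Y | φ z ∈ U}, ?_, rfl⟩
  exact (isOpen_discrete U).preimage (continuous_apply z)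

theorem aux_basic {Y : Type*} (U : Set (Equiv.Perm Y)) (hU : @IsOpen _ (permTop Y) U)
    (f : Equiv.Perm Y) (hf : f ∈ U) :
    ∃ F : Set Y, F.Finite ∧ ∀ g : Equiv.Perm Y, (∀ z ∈ F, g z = f z) → g ∈ U := by
  letI : TopologicalSpace Y := ⊥
  obtain ⟨V, hV, rfl⟩ := hU
  obtain ⟨I, u, hu, hI⟩ := isOpen_pi_iff.1 hV (f : Y → Y) hf
  refine ⟨I, I.finite_toSet, fun g hg => hI ?_⟩
  intro z hz
  show g z ∈ u z
  rw [hg z hz]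
  exact (hu z hz).2

open PartialBij in
/-- If `X ⊆ Y` is infinite and `|X| ≤ |Y \ X|`, then `π : S_∞(Y) → (I(X), τ_pp)`
is continuous, surjective and open. -/
theorem restrictPerm_continuous_surjective_open {Y : Type*} (X : Set Y)
    (hinf : X.Infinite) (hcard : Cardinal.mk X ≤ Cardinal.mk ↥(Xᶜ)) :
    @Continuous (Equiv.Perm Y) (PartialBij X) (permTop Y) (taupp X) (restrictPerm X) ∧
    Function.Surjective (restrictPerm X) ∧
    @IsOpenMap (Equiv.Perm Y) (PartialBij X) (permTop Y) (taupp X) (restrictPerm X) := by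
  refine ⟨?_, ?_, ?_⟩
  · letI := permTop Y
    refine continuous_generateFrom_iff.2 ?_
    rintro s ((⟨x, y, rfl⟩ | ⟨x, rfl⟩) | ⟨y, rfl⟩)
    · exact aux_eval_open (x : Y) {(y : Y)}
    · convert aux_eval_open (x : Y) Xᶜ using 1
      ext f
      constructor
      · intro hf hx
        exact hf ⟨⟨f x, hx⟩, rfl⟩
      · rintro hf ⟨y, hy⟩
        have hy : f x = y := hy
        exact hf (by rw [hy]; exact y.2)
    · have : restrictPerm X ⁻¹' w2 y =
          ⋃ z ∈ Xᶜ, {f : Equiv.Perm Y | f z ∈ ({(y : Y)} : Set Y)} := by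
        ext f
        simp only [Set.mem_iUnion]
        constructor
        · intro hf
          refine ⟨f.symm y, fun hx => hf ⟨⟨f.symm y, hx⟩, f.apply_symm_apply _⟩,
            f.apply_symm_apply _⟩
        · rintro ⟨z, hz, hzy⟩ ⟨x, hx⟩
          have hx : f x = y := hx
          have hzy : f z = y := hzy
          exact hz (f.injective (hzy.trans hx.symm) ▸ x.2)
      rw [this]
      exact isOpen_biUnion fun z _ => aux_eval_open z _
  · intro h
    obtain ⟨g, _, hg⟩ := aux_extend X hinf hcard h (Equiv.refl Y) ∅ Set.finite_empty
      (fun _ _ h => h.elim) (fun _ h => h.elim) (fun _ _ h => h.elim)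
    exact ⟨g, hg⟩
  · intro U hU
    letI := taupp X
    rw [isOpen_iff_forall_mem_open]
    rintro _ ⟨f, hf, rfl⟩
    obtain ⟨F, hF, hFU⟩ := aux_basic U hU f hf
    have ov : ∀ x y : X, IsOpen (v x y) := fun x y =>
      isOpen_generateFrom_of_mem (Or.inl (Or.inl ⟨x, y, rfl⟩))
    have o1 : ∀ x : X, IsOpen (w1 x) := fun x =>
      isOpen_generateFrom_of_mem (Or.inl (Or.inr ⟨x, rfl⟩))
    have o2 : ∀ y : X, IsOpen (w2 y) := fun y =>
      isOpen_generateFrom_of_mem (Or.inr ⟨y, rfl⟩)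
    let N : Y → Set (PartialBij X) := fun z => {h |
      (∀ (hz : z ∈ X) (hy : f z ∈ X), h ∈ v (⟨z, hz⟩ : X) (⟨f z, hy⟩ : X)) ∧
      (∀ (hz : z ∈ X), f z ∉ X → h ∈ w1 (⟨z, hz⟩ : X)) ∧
      (∀ (hy : f z ∈ X), z ∉ X → h ∈ w2 (⟨f z, hy⟩ : X))}
    have hN : ∀ z, IsOpen (N z) := by
      intro z
      by_cases hz : z ∈ X <;> by_cases hy : f z ∈ X
      · simpa [N, hz, hy] using ov ⟨z, hz⟩ ⟨f z, hy⟩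
      · simpa [N, hz, hy] using o1 ⟨z, hz⟩
      · simpa [N, hz, hy] using o2 ⟨f z, hy⟩
      · simp [N, hz, hy]
    refine ⟨⋂ z ∈ F, N z, ?_, hF.isOpen_biInter fun z _ => hN z, ?_⟩
    · intro h hh
      have hh : ∀ z ∈ F, h ∈ N z := by simpa only [Set.mem_iInter] using hh
      obtain ⟨g, hgF, hg⟩ := aux_extend X hinf hcard h f F hF
        (by
          rintro ⟨x, hx⟩ ⟨y, hy⟩ hxF hxy
          have hxy : f x = y := hxy
          subst hxy
          exact (hh x hxF).1 hx hy)
        (fun x hxF hx => (hh x hxF).2.1 x.2 hx)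
        (by
          rintro z ⟨y, hy⟩ hzF hz hzy
          have hzy : f z = y := hzy
          subst hzy
          exact (hh z hzF).2.2 hy hz)
      exact ⟨g, hFU g hgF, hg⟩
    · simp only [Set.mem_iInter]
      intro z _
      refine ⟨fun hz hy => rfl, ?_, ?_⟩
      · rintro hz hy ⟨y, h⟩
        have h : f z = y := h
        exact hy (by rw [h]; exact y.2)
      · rintro hy hz ⟨x, h⟩
        have h : f x = f z := h
        exact hz (f.injective h ▸ x.2)
end
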